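/- arXiv:1708.04235 — 4 statements merged into one kernel-verified Lean document; each statement's English description precedes it below -/
import Mathlib

section
/- There exists a function f : [−1,1] → ℝ that is Lipschitz with Lipschitz constant 1 such that limsup_{n→∞} (n/log n) · sup_{x∈[−1,1]} |B_n(f,x) − f(x)| > 0. -/
open Filter Set MeasureTheory

noncomputable section

/-- Equally spaced nodes `x_{k,n} = 2k/n - 1`. -/
def node (n k : ℕ) : ℝ := 2 * k / n - 1

/-- `x` is one of the nodes `x_{0,n}, …, x_{n,n}`. -/
def isNode (n : ℕ) (x : ℝ) : Prop := ∃ k ≤ n, x = node n k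

/-- Denominator of Berrut's interpolant. -/
def Dden (n : ℕ) (x : ℝ) : ℝ :=
  ∑ k ∈ Finset.range (n + 1), (-1 : ℝ) ^ k / (x - node n k)

/-- Numerator of Berrut's interpolant. -/
def Nnum (f : ℝ → ℝ) (n : ℕ) (x : ℝ) : ℝ :=
  ∑ k ∈ Finset.range (n + 1), (-1 : ℝ) ^ k * f (node n k) / (x - node n k)

open Classical in
/-- Berrut's barycentric interpolant. -/
def berrut (f : ℝ → ℝ) (n : ℕ) (x : ℝ) : ℝ :=
  if isNode n x then f x else Nnum f n x / Dden n x

/-- The odd bias function `O(f,x)`. -/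
def Ofun (f : ℝ → ℝ) (x : ℝ) : ℝ :=
  (f x - f 1) / (2 * (x - 1)) - (f x - f (-1)) / (2 * (x + 1))

/-- The even bias function `E(f,x)`. -/
def Efun (f : ℝ → ℝ) (x : ℝ) : ℝ :=
  (f 1 - f x) / (2 * (x - 1)) + (f (-1) - f x) / (2 * (x + 1))

/-- `f` is differentiable on `[-1,1]` with absolutely continuous derivative. -/
def AC1 (f : ℝ → ℝ) : Prop :=
  ∃ f' : ℝ → ℝ,
    (∀ x ∈ Set.Icc (-1 : ℝ) 1, HasDerivWithinAt f (f' x) (Set.Icc (-1 : ℝ) 1) x) ∧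
    ∃ g : ℝ → ℝ, IntervalIntegrable g volume (-1) 1 ∧
      ∀ x ∈ Set.Icc (-1 : ℝ) 1, f' x = f' (-1) + ∫ t in (-1 : ℝ)..x, g t

/-- `x` is regular for the sequence `n j`: eventually never a node. -/
def Regular (n : ℕ → ℕ) (x : ℝ) : Prop := ∃ j₀, ∀ j ≥ j₀, ¬ isNode (n j) x

/-- The function `A(x) = Σ (-1)^k (4k+2)/((2k+1)^2 - x)`. -/
def Afun (x : ℝ) : ℝ := ∑' k : ℕ, (-1 : ℝ) ^ k * (4 * k + 2) / ((2 * k + 1) ^ 2 - x)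

/-- `ι_n(x) = ⌊n(x+1)/2⌋`. -/
def iota (n : ℕ) (x : ℝ) : ℤ := ⌊(n : ℝ) * (x + 1) / 2⌋

/-- `ρ_n(x) = n(x - x_{ι_n(x),n}) - 1 = n(x+1) - 2 ι_n(x) - 1`. -/
def rho (n : ℕ) (x : ℝ) : ℝ := (n : ℝ) * (x + 1) - 2 * (iota n x : ℝ) - 1

open Classical in
/-- The de-biased numerator `Δ_n(f,x)`. -/
def Delta (f : ℝ → ℝ) (n : ℕ) (x : ℝ) : ℝ :=
  if isNode n x then 0 else
    (f (-1) - f x) / (2 * (x + 1)) + (-1 : ℝ) ^ n * (f 1 - f x) / (2 * (x - 1)) +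
      (1 / (n : ℝ)) * ∑ k ∈ Finset.Ioo 0 n, (-1 : ℝ) ^ k * (f (node n k) - f x) / (x - node n k)

end

lemma alt_bounds (m : ℕ) : ∀ a : ℕ → ℝ, Antitone a → (∀ i, 0 ≤ a i) →
    0 ≤ ∑ i ∈ Finset.range m, (-1 : ℝ) ^ i * a i ∧
      ∑ i ∈ Finset.range m, (-1 : ℝ) ^ i * a i ≤ a 0 := by
  induction m with
  | zero => intro a _ h0; simpa using h0 0
  | succ m ih =>
    intro a ha h0
    obtain ⟨h1, h2⟩ := ih (fun i => a (i + 1)) (fun i j hij => ha (by omega)) (fun i => h0 _)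
    have e : ∑ i ∈ Finset.range (m + 1), (-1 : ℝ) ^ i * a i
        = a 0 - ∑ i ∈ Finset.range m, (-1 : ℝ) ^ i * a (i + 1) := by
      rw [Finset.sum_range_succ', sub_eq_add_neg, ← Finset.sum_neg_distrib, add_comm]
      congr 1
      · simp
      · refine Finset.sum_congr rfl fun i _ => ?_
        ring
    have h3 : a 1 ≤ a 0 := ha (by omega)
    simp only [zero_add] at h2
    rw [e]
    constructor <;> linarith

lemma alt_lower (m : ℕ) (a : ℕ → ℝ) (ha : Antitone a) (h0 : ∀ i, 0 ≤ a i) :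
    a 0 - a 1 ≤ ∑ i ∈ Finset.range (m + 1), (-1 : ℝ) ^ i * a i := by
  obtain ⟨h1, h2⟩ := alt_bounds m (fun i => a (i + 1)) (fun i j hij => ha (by omega)) (fun i => h0 _)
  have e : ∑ i ∈ Finset.range (m + 1), (-1 : ℝ) ^ i * a i
      = a 0 - ∑ i ∈ Finset.range m, (-1 : ℝ) ^ i * a (i + 1) := by
    rw [Finset.sum_range_succ', sub_eq_add_neg, ← Finset.sum_neg_distrib, add_comm]
    congr 1
    · simp
    · refine Finset.sum_congr rfl fun i _ => ?_
      ring
  simp only [zero_add] at h2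
  linarith

lemma alt_abs (γ : ℕ → ℝ) (h1 : ∀ i, |γ i| ≤ 1) (m : ℕ) :
    |∑ i ∈ Finset.range m, (-1 : ℝ) ^ i * γ i| ≤
      1 + ∑ i ∈ Finset.range m, |γ i - γ (i + 1)| := by
  induction m using Nat.strong_induction_on with
  | _ m ih =>
    match m with
    | 0 => simp
    | 1 =>
      simp only [Finset.sum_range_one, pow_zero, one_mul]
      have := abs_nonneg (γ 0 - γ (0 + 1))
      linarith [h1 0]
    | m + 2 =>
      have := ih m (by omega)
      rw [Finset.sum_range_succ, Finset.sum_range_succ, Finset.sum_range_succ _ (m + 1),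
        Finset.sum_range_succ _ m]
      have e : (-1 : ℝ) ^ m * γ m + (-1 : ℝ) ^ (m + 1) * γ (m + 1)
          = (-1 : ℝ) ^ m * (γ m - γ (m + 1)) := by ring
      rw [add_assoc, e]
      have h2 : |(-1 : ℝ) ^ m * (γ m - γ (m + 1))| = |γ m - γ (m + 1)| := by
        rw [abs_mul]; simp
      have h3 := abs_nonneg (γ (m + 1) - γ (m + 1 + 1))
      have h4 := abs_add_le (∑ i ∈ Finset.range m, (-1 : ℝ) ^ i * γ i)
        ((-1 : ℝ) ^ m * (γ m - γ (m + 1)))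
      linarith

lemma split_sum (φ : ℝ → ℝ) (n j : ℕ) (hj : j < n) (x : ℝ) :
    ∑ k ∈ Finset.range (n + 1), (-1 : ℝ) ^ k * φ (node n k) / (x - node n k)
    = (-1 : ℝ) ^ j *
      (∑ i ∈ Finset.range (j + 1), (-1 : ℝ) ^ i *
          (φ (x - ((x - node n j) + i * (2 / n))) / ((x - node n j) + i * (2 / n)))
      + ∑ i ∈ Finset.range (n - j), (-1 : ℝ) ^ i *
          (φ (x + ((2 / n - (x - node n j)) + i * (2 / n)))
            / ((2 / n - (x - node n j)) + i * (2 / n)))) := by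
  have hn : (n : ℝ) ≠ 0 := by
    have : 0 < n := by omega
    positivity
  have e : n + 1 = (j + 1) + (n - j) := by omega
  rw [e, Finset.sum_range_add, mul_add]
  congr 1
  · rw [← Finset.sum_range_reflect, Finset.mul_sum]
    refine Finset.sum_congr rfl fun i hi => ?_
    have hi' : i ≤ j := by simpa [Nat.lt_succ_iff] using hi
    obtain ⟨l, rfl⟩ := Nat.exists_eq_add_of_le hi'
    have e1 : i + l + 1 - 1 - i = l := by omega
    rw [e1]
    have e2 : x - node n (i + l) + i * (2 / n) = x - node n l := by
      unfold node; push_cast; field_simp; ring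
    rw [e2]
    have e3 : x - (x - node n l) = node n l := by ring
    rw [e3]
    have e4 : (-1 : ℝ) ^ (i + l) * (-1) ^ i = (-1) ^ l := by
      rw [pow_add, mul_right_comm, ← mul_pow]; simp
    rw [← mul_assoc, e4, mul_div_assoc]
  · rw [Finset.mul_sum]
    refine Finset.sum_congr rfl fun i hi => ?_
    have e2 : 2 / n - (x - node n j) + i * (2 / n) = node n (j + 1 + i) - x := by
      unfold node; push_cast; field_simp; ring
    rw [e2]
    have e3 : x + (node n (j + 1 + i) - x) = node n (j + 1 + i) := by ring
    rw [e3, ← neg_sub x, div_neg, pow_add, pow_succ]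
    ring

lemma side_bound (f : ℝ → ℝ) (hf : ∀ a b, |f a - f b| ≤ |a - b|) (x s h σ : ℝ) (hσ : |σ| = 1)
    (hs : 0 < s) (hh : 0 < h) (m : ℕ) :
    |∑ i ∈ Finset.range m, (-1 : ℝ) ^ i * ((f (x + σ * (s + i * h)) - f x) / (s + i * h))|
      ≤ 3 + 2 * Real.log m := by
  have hd : ∀ i : ℕ, 0 < s + i * h := fun i => by positivity
  have hF : ∀ i : ℕ, |f (x + σ * (s + i * h)) - f x| ≤ s + i * h := fun i => by
    refine (hf _ _).trans ?_
    rw [add_sub_cancel_left, abs_mul, hσ, one_mul, abs_of_pos (hd i)]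
  refine (alt_abs (fun i : ℕ => (f (x + σ * (s + i * h)) - f x) / (s + i * h)) ?_ m).trans ?_
  · intro i
    rw [abs_div, abs_of_pos (hd i), div_le_one (hd i)]
    exact hF i
  · have key : ∀ i : ℕ, |(f (x + σ * (s + i * h)) - f x) / (s + i * h)
        - (f (x + σ * (s + (i + 1 : ℕ) * h)) - f x) / (s + (i + 1 : ℕ) * h)|
        ≤ 2 * ((i + 1 : ℕ) : ℝ)⁻¹ := by
      intro i
      have h1 := hd i
      have h2 := hd (i + 1)
      have h3 := hF i
      have h4 : |f (x + σ * (s + i * h)) - f (x + σ * (s + (i + 1 : ℕ) * h))| ≤ h := by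
        refine (hf _ _).trans ?_
        have : x + σ * (s + i * h) - (x + σ * (s + (i + 1 : ℕ) * h)) = σ * (-h) := by
          push_cast; ring
        rw [this, abs_mul, hσ, one_mul, abs_neg, abs_of_pos hh]
      have e : (f (x + σ * (s + i * h)) - f x) / (s + i * h)
        - (f (x + σ * (s + (i + 1 : ℕ) * h)) - f x) / (s + (i + 1 : ℕ) * h)
        = (f (x + σ * (s + i * h)) - f (x + σ * (s + (i + 1 : ℕ) * h))) / (s + (i + 1 : ℕ) * h)
          + (f (x + σ * (s + i * h)) - f x) / (s + i * h) * (h / (s + (i + 1 : ℕ) * h)) := by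
        have : h = (s + (i + 1 : ℕ) * h) - (s + i * h) := by push_cast; ring
        generalize f (x + σ * (s + i * h)) = A at *
        generalize f (x + σ * (s + (i + 1 : ℕ) * h)) = B at *
        generalize s + (i + 1 : ℕ) * h = d2 at *
        generalize s + i * h = d1 at *
        rw [this]
        field_simp
        ring
      rw [e]
      have b1 : |(f (x + σ * (s + i * h)) - f (x + σ * (s + (i + 1 : ℕ) * h)))
          / (s + (i + 1 : ℕ) * h)| ≤ h / (s + (i + 1 : ℕ) * h) := by
        rw [abs_div, abs_of_pos h2]; gcongr
      have b2 : |(f (x + σ * (s + i * h)) - f x) / (s + i * h) * (h / (s + (i + 1 : ℕ) * h))|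
          ≤ 1 * (h / (s + (i + 1 : ℕ) * h)) := by
        rw [abs_mul, abs_of_pos (div_pos hh h2)]
        gcongr
        rw [abs_div, abs_of_pos h1, div_le_one h1]; exact h3
      have b3 : h / (s + (i + 1 : ℕ) * h) ≤ ((i + 1 : ℕ) : ℝ)⁻¹ := by
        rw [inv_eq_one_div, div_le_div_iff₀ h2 (by positivity)]
        nlinarith
      have := abs_add_le ((f (x + σ * (s + i * h)) - f (x + σ * (s + (i + 1 : ℕ) * h)))
          / (s + (i + 1 : ℕ) * h)) ((f (x + σ * (s + i * h)) - f x) / (s + i * h)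
            * (h / (s + (i + 1 : ℕ) * h)))
      linarith
    have h5 : ∑ i ∈ Finset.range m, |(f (x + σ * (s + i * h)) - f x) / (s + i * h)
        - (f (x + σ * (s + (i + 1 : ℕ) * h)) - f x) / (s + (i + 1 : ℕ) * h)|
        ≤ 2 * ∑ i ∈ Finset.range m, ((i + 1 : ℕ) : ℝ)⁻¹ := by
      rw [Finset.mul_sum]
      exact Finset.sum_le_sum fun i _ => key i
    have h6 := harmonic_le_one_add_log m
    unfold harmonic at h6
    push_cast at h6 h5 ⊢
    linarith

lemma anti_inv (s h : ℝ) (hs : 0 < s) (hh : 0 < h) :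
    Antitone (fun i : ℕ => 1 / (s + i * h)) := by
  intro i j hij
  have : (i : ℝ) ≤ j := by exact_mod_cast hij
  simp only
  gcongr

lemma Dden_split (n j : ℕ) (hj : j < n) (x : ℝ) :
    Dden n x = (-1 : ℝ) ^ j *
      (∑ i ∈ Finset.range (j + 1), (-1 : ℝ) ^ i * (1 / ((x - node n j) + i * (2 / n)))
      + ∑ i ∈ Finset.range (n - j), (-1 : ℝ) ^ i *
          (1 / ((2 / n - (x - node n j)) + i * (2 / n)))) := by
  have := split_sum (fun _ => 1) n j hj x
  simp only [mul_one] at this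
  exact this

lemma Dden_lower (n j : ℕ) (hj : j < n) (x : ℝ) (h1 : 0 < x - node n j)
    (h2 : 0 < 2 / n - (x - node n j)) : (n : ℝ) / 4 ≤ |Dden n x| := by
  have hn : (0 : ℝ) < n := by
    have : 0 < n := by omega
    exact_mod_cast this
  have hh : (0 : ℝ) < 2 / n := by positivity
  rw [Dden_split n j hj x, abs_mul]
  have a1 := alt_lower j _ (anti_inv _ _ h1 hh) (fun i => by positivity)
  have a2 := (alt_bounds (n - j) _ (anti_inv _ _ h2 hh) (fun i => by positivity)).1
  simp only [abs_pow, abs_neg, abs_one, one_pow, one_mul]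
  refine le_trans ?_ (le_abs_self _)
  refine le_trans ?_ (add_le_add a1 a2)
  generalize x - node n j = s at *
  rw [add_zero]
  have hs : n * s < 2 := by
    have : s < 2 / n := by linarith
    rw [lt_div_iff₀ hn] at this; linarith
  simp only [Nat.cast_zero, Nat.cast_one, zero_mul, add_zero, one_mul]
  have e : 1 / s - 1 / (s + 2 / n) = 2 / (s * (n * s + 2)) := by
    field_simp
    ring
  rw [e, div_le_div_iff₀ (by norm_num) (by positivity)]
  nlinarith [mul_pos hn h1]

lemma upper (f : ℝ → ℝ) (hf : ∀ a b, |f a - f b| ≤ |a - b|) (n : ℕ) (hn : 1 ≤ n) (x : ℝ)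
    (hx : x ∈ Set.Icc (-1 : ℝ) 1) :
    |berrut f n x - f x| ≤ (24 + 16 * Real.log n) / n := by
  have hn0 : (0 : ℝ) < n := by exact_mod_cast hn
  have hlog : 0 ≤ Real.log n := Real.log_natCast_nonneg n
  unfold berrut
  split_ifs with hnode
  · rw [sub_self, abs_zero]; positivity
  · obtain ⟨hx1, hx2⟩ := hx
    set j := ⌊(n : ℝ) * (x + 1) / 2⌋₊ with hjdef
    have hy : 0 ≤ (n : ℝ) * (x + 1) / 2 := by
      have : 0 ≤ x + 1 := by linarith
      positivity
    have hj1 : (j : ℝ) ≤ (n : ℝ) * (x + 1) / 2 := Nat.floor_le hy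
    have hj2 : (n : ℝ) * (x + 1) / 2 < j + 1 := Nat.lt_floor_add_one _
    have hxne : x ≠ 1 := by
      intro h
      apply hnode
      refine ⟨n, le_rfl, ?_⟩
      unfold node; field_simp; linarith
    have hxlt : x < 1 := lt_of_le_of_ne hx2 hxne
    have hjn : j < n := by
      have : (j : ℝ) < n := by nlinarith
      exact_mod_cast this
    have hs : 0 < x - node n j := by
      have : x ≠ node n j := fun h => hnode ⟨j, hjn.le, h⟩
      have h2 : node n j ≤ x := by
        unfold node
        rw [sub_le_iff_le_add, div_le_iff₀ hn0]; linarith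
      exact sub_pos.2 (lt_of_le_of_ne h2 this.symm)
    have hs' : 0 < 2 / n - (x - node n j) := by
      have : x < 2 / n + node n j := by
        unfold node
        have : x + 1 < (2 + 2 * j) / n := by
          rw [lt_div_iff₀ hn0]; linarith
        rw [add_div] at this; linarith
      linarith
    have hD := Dden_lower n j hjn x hs hs'
    have hDpos : 0 < |Dden n x| := lt_of_lt_of_le (by positivity) hD
    have hD0 : Dden n x ≠ 0 := abs_pos.1 hDpos
    have e : Nnum f n x / Dden n x - f x = (Nnum f n x - f x * Dden n x) / Dden n x := by
      field_simp
    have e2 : Nnum f n x - f x * Dden n x = ∑ k ∈ Finset.range (n + 1),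
        (-1 : ℝ) ^ k * (fun t => f t - f x) (node n k) / (x - node n k) := by
      unfold Nnum Dden
      rw [Finset.mul_sum, ← Finset.sum_sub_distrib]
      refine Finset.sum_congr rfl fun k _ => ?_
      ring
    have hh : (0 : ℝ) < 2 / n := by positivity
    have b1 := side_bound f hf x _ _ (-1) (by simp) hs hh (j + 1)
    have b2 := side_bound f hf x _ _ 1 (by simp) hs' hh (n - j)
    have l1 : Real.log ((j + 1 : ℕ) : ℝ) ≤ Real.log n := by
      apply Real.log_le_log (by positivity)
      exact_mod_cast hjn
    have l2 : Real.log ((n - j : ℕ) : ℝ) ≤ Real.log n := by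
      apply Real.log_le_log
      · have : 0 < n - j := by omega
        exact_mod_cast this
      · exact_mod_cast Nat.sub_le n j
    have hN : |Nnum f n x - f x * Dden n x| ≤ 6 + 4 * Real.log n := by
      rw [e2, split_sum (fun t => f t - f x) n j hjn x, abs_mul]
      simp only [abs_pow, abs_neg, abs_one, one_pow, one_mul]
      simp only [neg_one_mul, ← sub_eq_add_neg] at b1
      simp only [one_mul] at b2
      refine (abs_add_le _ _).trans ?_
      linarith
    rw [e, abs_div, div_le_div_iff₀ hDpos hn0]
    have : 0 ≤ 6 + 4 * Real.log n := by positivity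
    nlinarith [mul_le_mul_of_nonneg_left hD this, mul_le_mul_of_nonneg_right hN hn0.le]

def qq (j : ℕ) : ℕ := 3 ^ (20 ^ (j + 1))

lemma qq_big (j : ℕ) : 3 ^ 20 ≤ qq j := by
  unfold qq
  apply Nat.pow_le_pow_right (by norm_num)
  rw [pow_succ]
  have : 1 ≤ 20 ^ j := Nat.one_le_pow _ _ (by norm_num)
  omega

lemma qq_sep {i j : ℕ} (h : i < j) : qq i ^ 20 ≤ qq j := by
  unfold qq
  rw [← pow_mul, ← pow_succ]
  apply Nat.pow_le_pow_right (by norm_num)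
  apply Nat.pow_le_pow_right (by norm_num)
  omega

lemma qq_mod (j : ℕ) : ∃ P, qq j ^ 10 = 4 * P + 1 := by
  have : qq j ^ 10 % 4 = 1 := by
    unfold qq
    rw [← pow_mul, mul_comm, show 10 = 2 * 5 from rfl, mul_assoc, pow_mul, Nat.pow_mod]
    norm_num
  exact ⟨qq j ^ 10 / 4, by omega⟩

def SS : Set ℝ := Set.Iic 0 ∪
  {s | ∃ j i : ℕ, qq j ≤ i ∧ i < qq j ^ 9 ∧ s = (4 * i + 3) / (qq j : ℝ) ^ 10}

noncomputable def FF (t : ℝ) : ℝ := Metric.infDist t SS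

lemma FF_lip : LipschitzWith 1 FF := Metric.lipschitz_infDist_pt SS

lemma FF_lip' (a b : ℝ) : |FF a - FF b| ≤ |a - b| := by
  have := FF_lip.dist_le_mul a b
  simpa [Real.dist_eq] using this

lemma FF_nonneg (t : ℝ) : 0 ≤ FF t := Metric.infDist_nonneg

lemma FF_nonpos {t : ℝ} (ht : t ≤ 0) : FF t = 0 :=
  Metric.infDist_zero_of_mem (Or.inl ht)

lemma FF_zero {j i : ℕ} (h1 : qq j ≤ i) (h2 : i < qq j ^ 9) :
    FF ((4 * i + 3) / (qq j : ℝ) ^ 10) = 0 :=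
  Metric.infDist_zero_of_mem (Or.inr ⟨j, i, h1, h2, rfl⟩)

lemma FF_ge {j p : ℕ} (h1 : qq j ≤ p) (h2 : p < qq j ^ 9) :
    2 / (qq j : ℝ) ^ 10 ≤ FF ((4 * p + 1) / (qq j : ℝ) ^ 10) := by
  unfold FF
  rw [Metric.le_infDist (s := SS) ⟨(0 : ℝ), Or.inl (le_refl (0 : ℝ))⟩]
  have hq : (3 : ℝ) ^ 20 ≤ qq j := by exact_mod_cast qq_big j
  have hq1 : (1 : ℝ) ≤ qq j := le_trans (by norm_num) hq
  have hp1 : (qq j : ℝ) ≤ p := by exact_mod_cast h1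
  have hp2 : (p : ℝ) + 1 ≤ (qq j : ℝ) ^ 9 := by exact_mod_cast h2
  intro y hy
  rw [Real.dist_eq]
  rcases hy with hy | ⟨l, i, hi1, hi2, rfl⟩
  · have hy : y ≤ 0 := hy
    refine le_trans ?_ (le_abs_self _)
    have : 2 / (qq j : ℝ) ^ 10 ≤ (4 * p + 1) / (qq j : ℝ) ^ 10 := by
      gcongr; linarith
    linarith
  · have hQ : (3 : ℝ) ^ 20 ≤ qq l := by exact_mod_cast qq_big l
    have hQ1 : (1 : ℝ) ≤ qq l := le_trans (by norm_num) hQ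
    have hi1' : (qq l : ℝ) ≤ i := by exact_mod_cast hi1
    have hi2' : (i : ℝ) + 1 ≤ (qq l : ℝ) ^ 9 := by exact_mod_cast hi2
    rcases lt_trichotomy l j with hlj | rfl | hlj
    · have hs : (qq l : ℝ) ^ 20 ≤ qq j := by exact_mod_cast qq_sep hlj
      generalize (qq l : ℝ) = Q at *
      generalize (qq j : ℝ) = q at *
      have hq0 : 0 < q := by linarith
      have hQ0 : 0 < Q := by linarith
      rw [abs_sub_comm]
      refine le_trans ?_ (le_abs_self _)
      have a1 : 4 / Q ^ 9 ≤ (4 * i + 3) / Q ^ 10 := by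
        rw [div_le_div_iff₀ (by positivity) (by positivity)]
        have : 4 * Q ^ 10 = 4 * Q * Q ^ 9 := by ring
        rw [this]; gcongr; linarith
      have a2 : (4 * p + 1) / q ^ 10 ≤ 4 / q := by
        rw [div_le_div_iff₀ (by positivity) (by positivity)]
        have : 4 * q ^ 10 = 4 * q ^ 9 * q := by ring
        rw [this]; gcongr; linarith
      have a3 : 8 / q ≤ 4 / Q ^ 9 := by
        rw [div_le_div_iff₀ (by positivity) (by positivity)]
        have : Q ^ 20 = Q ^ 11 * Q ^ 9 := by ring
        have h11 : Q ≤ Q ^ 11 := le_self_pow₀ hQ1 (by norm_num)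
        have : 2 * Q ^ 9 ≤ Q ^ 11 * Q ^ 9 := by
          gcongr; linarith
        linarith
      have a4 : 2 / q ^ 10 ≤ 4 / q := by
        gcongr
        · norm_num
        · exact le_self_pow₀ hq1 (by norm_num)
      have : 8 / q = 4 / q + 4 / q := by ring
      linarith
    · rw [← sub_div, abs_div, abs_of_pos (a := (qq l : ℝ) ^ 10) (by positivity)]
      gcongr
      have : (2 : ℤ) ≤ |4 * (p : ℤ) + 1 - (4 * i + 3)| := by
        rcases abs_cases (4 * (p : ℤ) + 1 - (4 * i + 3)) with h | h <;> omega
      exact_mod_cast this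
    · have hs : (qq j : ℝ) ^ 20 ≤ qq l := by exact_mod_cast qq_sep hlj
      generalize (qq l : ℝ) = Q at *
      generalize (qq j : ℝ) = q at *
      have hq0 : 0 < q := by linarith
      have hQ0 : 0 < Q := by linarith
      refine le_trans ?_ (le_abs_self _)
      have a1 : 4 / q ^ 9 ≤ (4 * p + 1) / q ^ 10 := by
        rw [div_le_div_iff₀ (by positivity) (by positivity)]
        have : 4 * q ^ 10 = 4 * q * q ^ 9 := by ring
        rw [this]; gcongr; linarith
      have a2 : (4 * i + 3) / Q ^ 10 ≤ 4 / Q := by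
        rw [div_le_div_iff₀ (by positivity) (by positivity)]
        have : 4 * Q ^ 10 = 4 * Q ^ 9 * Q := by ring
        rw [this]; gcongr; linarith
      have a3 : 4 / Q ≤ 1 / q ^ 9 := by
        rw [div_le_div_iff₀ (by positivity) (by positivity)]
        have : q ^ 20 = q ^ 11 * q ^ 9 := by ring
        have h11 : q ≤ q ^ 11 := le_self_pow₀ hq1 (by norm_num)
        have : 4 * q ^ 9 ≤ q ^ 11 * q ^ 9 := by
          gcongr; linarith
        linarith
      have a4 : 2 / q ^ 10 ≤ 2 / q ^ 9 := by
        gcongr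
        · norm_num
      have e1 : 4 / q ^ 9 = 4 * (1 / q ^ 9) := by ring
      have e2 : 2 / q ^ 9 = 2 * (1 / q ^ 9) := by ring
      have : 0 < 1 / q ^ 9 := by positivity
      linarith

lemma pair_sum (c : ℕ → ℝ) (P : ℕ) : ∑ i ∈ Finset.range (2 * P + 1), (-1 : ℝ) ^ i * c i
    = ∑ p ∈ Finset.range P, (c (2 * p) - c (2 * p + 1)) + c (2 * P) := by
  induction P with
  | zero => simp
  | succ P ih =>
    rw [show 2 * (P + 1) + 1 = 2 * P + 1 + 1 + 1 by ring, Finset.sum_range_succ,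
      Finset.sum_range_succ, ih, Finset.sum_range_succ]
    have : (-1 : ℝ) ^ (2 * P) = 1 := by simp
    rw [pow_succ _ (2 * P + 1), pow_succ _ (2 * P), this, show 2 * (P + 1) = 2 * P + 1 + 1 by ring]
    ring

lemma log_dec (d : ℕ → ℝ) (hd : ∀ p : ℕ, -(2 / (4 * p + 3)) ≤ d p) (K0 K : ℕ) (h0 : 1 ≤ K0)
    (hK : K0 ≤ K) : ∑ p ∈ Finset.range K0, d p
      - (Real.log (4 * K - 1) - Real.log (4 * K0 - 1)) / 2 ≤ ∑ p ∈ Finset.range K, d p := by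
  induction K, hK using Nat.le_induction with
  | base => simp
  | succ K hK ih =>
    rw [Finset.sum_range_succ]
    have := hd K
    have hK1 : (1 : ℝ) ≤ K := by exact_mod_cast h0.trans hK
    have p1 : (0 : ℝ) < 4 * K - 1 := by linarith
    have p2 : (0 : ℝ) < 4 * K + 3 := by linarith
    have h := Real.one_sub_inv_le_log_of_pos (div_pos p2 p1)
    rw [Real.log_div p2.ne' p1.ne', inv_div] at h
    have e : 1 - (4 * (K : ℝ) - 1) / (4 * K + 3) = 2 * (2 / (4 * K + 3)) := by
      field_simp; ring
    rw [e] at h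
    push_cast
    have e2 : 4 * ((K : ℝ) + 1) - 1 = 4 * K + 3 := by ring
    rw [e2]
    linarith

lemma log_inc (d : ℕ → ℝ) (K0 K : ℕ) (hd : ∀ p : ℕ, K0 ≤ p → p < K → 2 / (4 * p + 1) ≤ d p)
    (hK : K0 ≤ K) : ∑ p ∈ Finset.range K0, d p
      + (Real.log (4 * K + 1) - Real.log (4 * K0 + 1)) / 2 ≤ ∑ p ∈ Finset.range K, d p := by
  induction K, hK using Nat.le_induction with
  | base => simp
  | succ K hK ih =>
    rw [Finset.sum_range_succ]
    have := hd K hK (by omega)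
    have ih := ih (fun p h1 h2 => hd p h1 (by omega))
    have p1 : (0 : ℝ) < 4 * K + 1 := by positivity
    have p2 : (0 : ℝ) < 4 * K + 5 := by positivity
    have h := Real.log_le_sub_one_of_pos (div_pos p2 p1)
    rw [Real.log_div p2.ne' p1.ne'] at h
    have e : (4 * (K : ℝ) + 5) / (4 * K + 1) - 1 = 2 * (2 / (4 * K + 1)) := by
      field_simp; ring
    rw [e] at h
    push_cast
    have e2 : 4 * ((K : ℝ) + 1) + 1 = 4 * K + 5 := by ring
    rw [e2]
    linarith

lemma log_three : (1 : ℝ) ≤ Real.log 3 := by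
  rw [Real.le_log_iff_exp_le (by norm_num)]
  linarith [Real.exp_one_lt_d9]

lemma sum_lower (j P : ℕ) (hP : qq j ^ 10 = 4 * P + 1) :
    2 * Real.log (qq j) ≤ ∑ i ∈ Finset.range (2 * P + 1), (-1 : ℝ) ^ i *
      (FF ((1 + 2 * i) / (qq j : ℝ) ^ 10) / ((1 + 2 * i) / (qq j : ℝ) ^ 10)) := by
  rw [pair_sum (fun i : ℕ => FF ((1 + 2 * i) / (qq j : ℝ) ^ 10) / ((1 + 2 * i) / (qq j : ℝ) ^ 10))]
  have hq : (3 : ℝ) ^ 20 ≤ qq j := by exact_mod_cast qq_big j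
  have hq1 : (1 : ℝ) ≤ qq j := le_trans (by norm_num) hq
  have hq0 : (0 : ℝ) < qq j := by linarith
  set d : ℕ → ℝ := fun p => FF ((1 + 2 * (2 * p : ℕ)) / (qq j : ℝ) ^ 10) /
      ((1 + 2 * (2 * p : ℕ)) / (qq j : ℝ) ^ 10)
    - FF ((1 + 2 * (2 * p + 1 : ℕ)) / (qq j : ℝ) ^ 10) /
      ((1 + 2 * (2 * p + 1 : ℕ)) / (qq j : ℝ) ^ 10) with hd
  have hd' : ∀ p, d p = (qq j : ℝ) ^ 10 * FF ((4 * p + 1) / (qq j : ℝ) ^ 10) / (4 * p + 1)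
      - (qq j : ℝ) ^ 10 * FF ((4 * p + 3) / (qq j : ℝ) ^ 10) / (4 * p + 3) := by
    intro p
    simp only [hd]
    have e1 : (1 + 2 * (2 * p : ℕ) : ℝ) = 4 * p + 1 := by push_cast; ring
    have e2 : (1 + 2 * (2 * p + 1 : ℕ) : ℝ) = 4 * p + 3 := by push_cast; ring
    rw [e1, e2]
    field_simp
  have dl : ∀ p : ℕ, -(2 / (4 * p + 3)) ≤ d p := by
    intro p
    rw [hd']
    have h1 := FF_lip' ((4 * p + 3) / (qq j : ℝ) ^ 10) ((4 * p + 1) / (qq j : ℝ) ^ 10)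
    have h2 := FF_nonneg ((4 * p + 1) / (qq j : ℝ) ^ 10)
    have e : ((4 * p + 3) / (qq j : ℝ) ^ 10 - (4 * p + 1) / (qq j : ℝ) ^ 10)
      = 2 / (qq j : ℝ) ^ 10 := by ring
    rw [e, abs_of_pos (a := 2 / (qq j : ℝ) ^ 10) (by positivity)] at h1
    have h3 := (le_abs_self _).trans h1
    rw [le_div_iff₀ (by positivity)] at h3
    generalize FF ((4 * p + 3) / (qq j : ℝ) ^ 10) = B at *
    generalize FF ((4 * p + 1) / (qq j : ℝ) ^ 10) = A at *
    have hA : 0 ≤ (qq j : ℝ) ^ 10 * A := by positivity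
    have h4 : (qq j : ℝ) ^ 10 * A / (4 * p + 3) ≤ (qq j : ℝ) ^ 10 * A / (4 * p + 1) := by
      gcongr; norm_num
    have h5 : (qq j : ℝ) ^ 10 * B / (4 * p + 3) ≤ ((qq j : ℝ) ^ 10 * A + 2) / (4 * p + 3) := by
      gcongr; linarith
    rw [add_div] at h5
    linarith
  have du : ∀ p : ℕ, qq j ≤ p → p < qq j ^ 9 → 2 / (4 * p + 1) ≤ d p := by
    intro p h1 h2
    rw [hd', FF_zero h1 h2]
    have := FF_ge h1 h2
    rw [div_le_iff₀ (by positivity)] at this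
    rw [mul_zero, zero_div, sub_zero]
    gcongr
    linarith
  have hqN : 3 ^ 20 ≤ qq j := qq_big j
  have hqN1 : 1 ≤ qq j := le_trans (by norm_num) hqN
  have hle : qq j ≤ qq j ^ 9 := Nat.le_self_pow (by norm_num) _
  have hle2 : qq j ^ 9 ≤ P := by
    have : qq j ^ 10 = qq j * qq j ^ 9 := by ring
    have h5 : 5 * qq j ^ 9 ≤ qq j * qq j ^ 9 := Nat.mul_le_mul_right _ (le_trans (by norm_num) hqN)
    omega
  have s1 := log_dec d dl 1 (qq j) le_rfl hqN1
  have s2 := log_inc d (qq j) (qq j ^ 9) du hle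
  have s3 := log_dec d dl (qq j ^ 9) P (hqN1.trans hle) hle2
  have s0 := dl 0
  have hlast : 0 ≤ FF ((1 + 2 * (2 * P : ℕ)) / (qq j : ℝ) ^ 10) /
      ((1 + 2 * (2 * P : ℕ)) / (qq j : ℝ) ^ 10) := div_nonneg (FF_nonneg _) (by positivity)
  refine le_trans ?_ (le_add_of_nonneg_right hlast)
  change _ ≤ ∑ p ∈ Finset.range P, d p
  have hL : 20 ≤ Real.log (qq j) := by
    have := Real.log_le_log (by norm_num) hq
    rw [Real.log_pow] at this
    push_cast at this
    linarith [log_three]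
  rw [Finset.sum_range_one] at s1
  push_cast at s1 s2 s3 s0
  have hPr : (qq j : ℝ) ^ 10 = 4 * P + 1 := by exact_mod_cast hP
  have hPpos : (1 : ℝ) ≤ P := by exact_mod_cast (hqN1.trans hle).trans hle2
  have q9 : (1 : ℝ) ≤ (qq j : ℝ) ^ 9 := one_le_pow₀ hq1
  have l1 : Real.log (4 * qq j - 1) ≤ Real.log 5 + Real.log (qq j) := by
    rw [← Real.log_mul (by norm_num) hq0.ne']
    exact Real.log_le_log (by linarith) (by linarith)
  have l2 : Real.log (4 * qq j + 1) ≤ Real.log 5 + Real.log (qq j) := by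
    rw [← Real.log_mul (by norm_num) hq0.ne']
    exact Real.log_le_log (by linarith) (by linarith)
  have l3 : 9 * Real.log (qq j) ≤ Real.log (4 * (qq j : ℝ) ^ 9 + 1) := by
    have := Real.log_pow (n := 9) (x := (qq j : ℝ))
    push_cast at this
    rw [← this]
    exact Real.log_le_log (by linarith) (by linarith)
  have l4 : 9 * Real.log (qq j) ≤ Real.log (4 * (qq j : ℝ) ^ 9 - 1) := by
    have := Real.log_pow (n := 9) (x := (qq j : ℝ))
    push_cast at this
    rw [← this]
    exact Real.log_le_log (by linarith) (by linarith)
  have l5 : Real.log (4 * (P : ℝ) - 1) ≤ 10 * Real.log (qq j) := by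
    have := Real.log_pow (n := 10) (x := (qq j : ℝ))
    push_cast at this
    rw [← this]
    exact Real.log_le_log (by linarith) (by linarith)
  have l6 : Real.log 5 ≤ 4 := by
    have := Real.log_le_sub_one_of_pos (x := 5) (by norm_num)
    linarith
  have l7 : 0 ≤ Real.log (4 * 1 - 1) := Real.log_nonneg (by norm_num)
  norm_num at s0
  clear_value d
  clear hlast hP hPr hd hd' dl du hqN hq
  generalize ∑ p ∈ Finset.range (qq j), d p = A1 at *
  generalize ∑ p ∈ Finset.range (qq j ^ 9), d p = A2 at *
  generalize ∑ p ∈ Finset.range P, d p = A3 at *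
  generalize Real.log (4 * (qq j : ℝ) ^ 9 + 1) = L1 at *
  generalize Real.log (4 * (qq j : ℝ) ^ 9 - 1) = L2 at *
  generalize Real.log (4 * (qq j : ℝ) + 1) = L3 at *
  generalize Real.log (4 * (qq j : ℝ) - 1) = L4 at *
  generalize Real.log (4 * (P : ℝ) - 1) = L5 at *
  generalize Real.log (qq j : ℝ) = L at *
  generalize Real.log (4 * 1 - 1) = L6 at *
  generalize Real.log 5 = L7 at *
  linarith only [s0, s1, s2, s3, l1, l2, l3, l4, l5, l6, l7, hL]

lemma berrut_lower (j : ℕ) :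
    Real.log ((qq j ^ 10 : ℕ) : ℝ) / 10 / ((qq j ^ 10 : ℕ) : ℝ)
      ≤ |berrut FF (qq j ^ 10) 0 - FF 0| := by
  obtain ⟨P, hP⟩ := qq_mod j
  have hs := sum_lower j P hP
  have hlogn : Real.log ((qq j ^ 10 : ℕ) : ℝ) = 10 * Real.log (qq j) := by
    push_cast; rw [Real.log_pow]; norm_num
  rw [hlogn]
  have hPr : (qq j : ℝ) ^ 10 = 4 * P + 1 := by exact_mod_cast hP
  have hL : 0 ≤ Real.log (qq j) := Real.log_natCast_nonneg _
  generalize Real.log (qq j) = L at *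
  rw [hPr] at hs
  rw [hP]
  have hn : (0 : ℝ) < ((4 * P + 1 : ℕ) : ℝ) := by positivity
  have hcast : ((4 * P + 1 : ℕ) : ℝ) = 4 * P + 1 := by push_cast; ring
  have hnode : ¬ isNode (4 * P + 1) 0 := by
    rintro ⟨k, _, hk⟩
    unfold node at hk
    have : (2 * k : ℝ) = ((4 * P + 1 : ℕ) : ℝ) := by
      field_simp at hk; linarith
    have : 2 * k = 4 * P + 1 := by exact_mod_cast this
    omega
  have e1 : (0 : ℝ) - node (4 * P + 1) (2 * P) = 1 / (4 * P + 1) := by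
    unfold node; rw [hcast]; push_cast; field_simp; ring
  have e2 : 2 / ((4 * P + 1 : ℕ) : ℝ) - (0 - node (4 * P + 1) (2 * P)) = 1 / (4 * P + 1) := by
    rw [e1, hcast]; ring
  have hlt : 2 * P < 4 * P + 1 := by omega
  have hDl := Dden_lower (4 * P + 1) (2 * P) hlt 0 (by rw [e1]; positivity)
    (by rw [e2]; positivity)
  have hDpos : 0 < |Dden (4 * P + 1) 0| := lt_of_lt_of_le (by positivity) hDl
  have hpos1 : (0 : ℝ) < 1 / (4 * P + 1) := by positivity
  have hpos2 : (0 : ℝ) < 2 / ((4 * P + 1 : ℕ) : ℝ) := by positivity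
  have hDu : |Dden (4 * P + 1) 0| ≤ 2 * (4 * P + 1) := by
    rw [Dden_split _ _ hlt, abs_mul, e2, e1]
    simp only [abs_pow, abs_neg, abs_one, one_pow, one_mul]
    have a1 := alt_bounds (2 * P + 1) _ (anti_inv _ _ hpos1 hpos2) (fun i => by positivity)
    have a2 := alt_bounds (4 * P + 1 - 2 * P) _ (anti_inv _ _ hpos1 hpos2)
      (fun i => by positivity)
    rw [abs_of_nonneg (add_nonneg a1.1 a2.1)]
    have e : 1 / (1 / (4 * (P : ℝ) + 1) + (0 : ℕ) * (2 / ((4 * P + 1 : ℕ) : ℝ))) = 4 * P + 1 := by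
      simp
    have a1' := a1.2
    have a2' := a2.2
    rw [e] at a1' a2'
    linarith
  have hN : 2 * L ≤ |Nnum FF (4 * P + 1) 0| := by
    unfold Nnum
    rw [split_sum FF _ _ hlt, abs_mul, e2, e1]
    simp only [abs_pow, abs_neg, abs_one, one_pow, one_mul]
    have z : ∀ i : ℕ, FF (0 - (1 / (4 * (P : ℝ) + 1) + i * (2 / ((4 * P + 1 : ℕ) : ℝ)))) = 0 := by
      intro i
      apply FF_nonpos
      have : 0 ≤ 1 / (4 * (P : ℝ) + 1) + i * (2 / ((4 * P + 1 : ℕ) : ℝ)) := by positivity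
      linarith
    simp only [z, zero_div, mul_zero, Finset.sum_const_zero, zero_add]
    refine le_trans ?_ (le_abs_self _)
    refine hs.trans (le_of_eq ?_)
    have e3 : 4 * P + 1 - 2 * P = 2 * P + 1 := by omega
    rw [e3]
    refine Finset.sum_congr rfl fun i _ => ?_
    have e4 : 1 / (4 * (P : ℝ) + 1) + i * (2 / ((4 * P + 1 : ℕ) : ℝ))
        = (1 + 2 * i) / (4 * P + 1) := by
      rw [hcast]; ring
    rw [e4]
  have hb : berrut FF (4 * P + 1) 0 = Nnum FF (4 * P + 1) 0 / Dden (4 * P + 1) 0 := by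
    unfold berrut; rw [if_neg hnode]
  rw [hb, FF_nonpos le_rfl, sub_zero, abs_div, div_le_div_iff₀ hn hDpos, hcast]
  have := mul_le_mul_of_nonneg_left hDu hL
  have := mul_le_mul_of_nonneg_right hN (by positivity : (0 : ℝ) ≤ 4 * P + 1)
  linarith

theorem qq_large (j : ℕ) : j ≤ qq j ^ 10 := by
  have h1 : j < 20 ^ j := Nat.lt_pow_self (by norm_num)
  have h2 : 20 ^ j ≤ 20 ^ (j + 1) := Nat.pow_le_pow_right (by norm_num) (by omega)
  have h3 : 20 ^ (j + 1) < qq j := Nat.lt_pow_self (by norm_num)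
  have h4 : qq j ≤ qq j ^ 10 := Nat.le_self_pow (by norm_num) _
  omega

/-- there is a Lipschitz-1 function on `[-1,1]` for which
`limsup (n / log n) · ‖B_n f - f‖_∞ > 0`. -/
theorem statement0 :
    ∃ f : ℝ → ℝ, LipschitzOnWith 1 f (Set.Icc (-1 : ℝ) 1) ∧
      0 < Filter.limsup
        (fun n : ℕ => ((n : ℝ) / Real.log n) *
          ⨆ x : Set.Icc (-1 : ℝ) 1, |berrut f n (x : ℝ) - f (x : ℝ)|) Filter.atTop := by
  refine ⟨FF, FF_lip.lipschitzOnWith, ?_⟩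
  have hne : Nonempty (Set.Icc (-1 : ℝ) 1) := ⟨⟨0, by norm_num, by norm_num⟩⟩
  refine lt_of_lt_of_le (by norm_num : (0 : ℝ) < 1 / 10) ?_
  apply Filter.le_limsup_of_frequently_le
  · rw [Filter.frequently_atTop]
    intro a
    refine ⟨qq a ^ 10, qq_large a, ?_⟩
    have hbd : BddAbove (Set.range fun x : Set.Icc (-1 : ℝ) 1 =>
        |berrut FF (qq a ^ 10) (x : ℝ) - FF (x : ℝ)|) := by
      refine ⟨(24 + 16 * Real.log (qq a ^ 10 : ℕ)) / (qq a ^ 10 : ℕ), ?_⟩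
      · rintro _ ⟨x, rfl⟩
        exact upper FF FF_lip' _ (Nat.one_le_pow _ _ (by unfold qq; positivity)) x x.2
    have h := (berrut_lower a).trans (le_ciSup hbd ⟨0, by norm_num, by norm_num⟩)
    have hq : 1 < qq a ^ 10 :=
      Nat.one_lt_pow (by norm_num) (lt_of_lt_of_le (by norm_num) (qq_big a))
    generalize qq a ^ 10 = n at *
    have hn : (1 : ℝ) < n := by exact_mod_cast hq
    have hl := Real.log_pos hn
    have hn0 : (0 : ℝ) < n := by linarith
    calc (1 / 10 : ℝ) = (n / Real.log n) * (Real.log n / 10 / n) := by field_simp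
      _ ≤ _ := by gcongr
  · refine Filter.isBoundedUnder_of_eventually_le (a := 40) ?_
    filter_upwards [Filter.eventually_ge_atTop 3] with n hn
    have hn3 : (3 : ℝ) ≤ n := by exact_mod_cast hn
    have hl : 1 ≤ Real.log n := log_three.trans (Real.log_le_log (by norm_num) hn3)
    have hn0 : (0 : ℝ) < n := by linarith
    have h : (⨆ x : Set.Icc (-1 : ℝ) 1, |berrut FF n (x : ℝ) - FF (x : ℝ)|)
        ≤ (24 + 16 * Real.log n) / n :=
      ciSup_le fun x => upper FF FF_lip' n (by omega) x x.2
    calc (n / Real.log n) * _ ≤ (n / Real.log n) * ((24 + 16 * Real.log n) / n) := by gcongr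
      _ = (24 + 16 * Real.log n) / Real.log n := by field_simp
      _ ≤ 40 := by rw [div_le_iff₀ (by linarith)]; linarith
end

section
/- Let f ∈ AC¹. Then n · sup_{x∈[−1,1]} |B_n(f,x) − f(x)| → 0 as n → ∞ along even integers n if and only if f is constant on [−1,1]. -/
open Filter Set MeasureTheory

noncomputable def TT (a : ℕ → ℝ) (m : ℕ) : ℝ :=
  ∑ k ∈ Finset.range (2*m+1), (-1:ℝ)^k * a k - (a 0 + a (2*m))/2

lemma TT_eq (a : ℕ → ℝ) (m : ℕ) :
    TT a m = (1/2) * ∑ i ∈ Finset.range m, (a (2*i) - 2 * a (2*i+1) + a (2*i+2)) := by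
  induction m with
  | zero => simp [TT]
  | succ m ih =>
    rw [Finset.sum_range_succ, mul_add, ← ih]
    unfold TT
    rw [show 2*(m+1)+1 = 2*m+1+1+1 by ring, Finset.sum_range_succ, Finset.sum_range_succ _ (2*m+1)]
    rw [show 2*(m+1) = 2*m+2 by ring, show 2*m+1+1 = 2*m+2 by ring]
    have h1 : (-1:ℝ)^(2*m+1) = -1 := Odd.neg_one_pow ⟨m, rfl⟩
    have h2 : (-1:ℝ)^(2*m+2) = 1 := Even.neg_one_pow ⟨m+1, by ring⟩
    rw [h1, h2]; ring

lemma TT_add (a b : ℕ → ℝ) (m : ℕ) : TT (fun k => a k + b k) m = TT a m + TT b m := by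
  unfold TT
  simp only [mul_add, Finset.sum_add_distrib]; ring

lemma TT_smooth (a : ℕ → ℝ) (m : ℕ) (c : ℝ)
    (h : ∀ i < m, |a (2*i) - 2 * a (2*i+1) + a (2*i+2)| ≤ c) : |TT a m| ≤ m * c / 2 := by
  rw [TT_eq, abs_mul]
  have := (Finset.abs_sum_le_sum_abs (fun i => a (2*i) - 2 * a (2*i+1) + a (2*i+2)) (Finset.range m)).trans
    (Finset.sum_le_sum (fun i hi => h i (Finset.mem_range.1 hi)))
  simp only [Finset.sum_const, Finset.card_range, nsmul_eq_mul] at this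
  rw [abs_of_pos (by norm_num : (0:ℝ) < 1/2)]
  linarith

lemma TT_bv (a b : ℕ → ℝ) (m : ℕ)
    (h : ∀ k < 2*m, |a (k+1) - a k| ≤ b (k+1) - b k) : |TT a m| ≤ (b (2*m) - b 0) / 2 := by
  rw [TT_eq, abs_mul, abs_of_pos (by norm_num : (0:ℝ) < 1/2)]
  have h2 : ∑ i ∈ Finset.range m, (b (2*(i+1)) - b (2*i)) = b (2*m) - b 0 :=
    Finset.sum_range_sub (fun i => b (2*i)) m
  have := (Finset.abs_sum_le_sum_abs (fun i => a (2*i) - 2 * a (2*i+1) + a (2*i+2)) (Finset.range m)).trans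
    (Finset.sum_le_sum (g := fun i => b (2*(i+1)) - b (2*i)) (fun i hi => by
      have hi := Finset.mem_range.1 hi
      have h1 := h (2*i) (by omega)
      have h2 := h (2*i+1) (by omega)
      rw [show 2*i+1+1 = 2*i+2 by ring] at h2
      rw [show 2*(i+1) = 2*i+2 by ring]
      rw [abs_le] at *
      constructor <;> linarith [h1.1, h1.2, h2.1, h2.2]))
  linarith

lemma alt_bound (m : ℕ) : ∀ (a : ℕ → ℝ), Antitone a → (∀ i, 0 ≤ a i) →
    a 0 - a 1 ≤ ∑ i ∈ Finset.range (m+1), (-1:ℝ)^i * a i ∧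
      ∑ i ∈ Finset.range (m+1), (-1:ℝ)^i * a i ≤ a 0 := by
  induction m with
  | zero => intro a _ hp; simp [hp 1]
  | succ m ih =>
    intro a ha hp
    have := ih (fun i => a (i+1)) (fun i j hij => ha (by omega)) (fun i => hp _)
    rw [Finset.sum_range_succ']
    have e : ∑ k ∈ Finset.range (m+1), (-1:ℝ)^(k+1) * a (k+1)
        = - ∑ k ∈ Finset.range (m+1), (-1:ℝ)^k * a (k+1) := by
      rw [← Finset.sum_neg_distrib]; exact Finset.sum_congr rfl (fun k _ => by ring)
    rw [e]
    have h12 : a (1+1) ≤ a 1 := ha (by omega)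
    simp only [zero_add, pow_zero, one_mul] at *
    constructor <;> linarith [this.1, this.2]

/-- scaled denominator -/
lemma alt_den (n j : ℕ) (hj : j < n) (y : ℝ) (h1 : (j:ℝ) < y) (h2 : y < j + 1) :
    1/2 ≤ |∑ k ∈ Finset.range (n+1), (-1:ℝ)^k / (y - k)| ∧
    |∑ k ∈ Finset.range (n+1), (-1:ℝ)^k / (y - k)| ≤ 1/(y-j) + 1/(j+1-y) := by
  obtain ⟨l, rfl⟩ : ∃ l, n = j + 1 + l := ⟨n - (j+1), by omega⟩
  rw [show j+1+l+1 = (j+1) + (l+1) by ring, Finset.sum_range_add]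
  have pos : ∀ {c : ℝ}, 0 < c → Antitone (fun i : ℕ => 1/(c+i)) ∧ ∀ i : ℕ, 0 ≤ 1/(c+(i:ℝ)) := by
    intro c hc
    refine ⟨fun i i' h => ?_, fun i => by positivity⟩
    have : (i:ℝ) ≤ i' := by exact_mod_cast h
    exact one_div_le_one_div_of_le (by positivity) (by linarith)
  have eA : ∑ k ∈ Finset.range (j+1), (-1:ℝ)^k / (y - k)
      = (-1)^j * ∑ i ∈ Finset.range (j+1), (-1:ℝ)^i * (1/((y-j)+i)) := by
    rw [← Finset.sum_range_reflect, Finset.mul_sum]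
    refine Finset.sum_congr rfl (fun i hi => ?_)
    have hi := Finset.mem_range.1 hi
    have hi' : i ≤ j := by omega
    rw [show j + 1 - 1 - i = j - i by omega, Nat.cast_sub hi']
    have : (-1:ℝ)^j = (-1)^(j-i) * (-1)^i := by rw [← pow_add]; congr 1; omega
    have e3 : (-1:ℝ)^i * (-1)^i = 1 := by rw [← mul_pow]; norm_num
    rw [this, show y - ((j:ℝ) - i) = (y - j) + i by ring]
    rw [mul_assoc, ← mul_assoc ((-1:ℝ)^i), e3]; ring
  have eB : ∑ k ∈ Finset.range (l+1), (-1:ℝ)^(j+1+k) / (y - ((j+1+k : ℕ):ℝ))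
      = (-1)^j * ∑ i ∈ Finset.range (l+1), (-1:ℝ)^i * (1/((j+1-y)+i)) := by
    rw [Finset.mul_sum]
    refine Finset.sum_congr rfl (fun i hi => ?_)
    push_cast
    rw [show y - ((j:ℝ)+1+i) = -((j+1-y)+i) by ring, div_neg, pow_add, pow_add]
    ring
  rw [eA, eB, ← mul_add, abs_mul, abs_pow]
  simp only [abs_neg, abs_one, one_pow, one_mul]
  have A := alt_bound j _ (pos (show 0 < y - j by linarith)).1 (pos (show 0 < y - j by linarith)).2
  have B := alt_bound l _ (pos (show 0 < j + 1 - y by linarith)).1 (pos (show 0 < j + 1 - y by linarith)).2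
  have B' := (pos (show 0 < j + 1 - y by linarith)).1 (show 0 ≤ 1 by omega)
  simp only [Nat.cast_zero, add_zero, Nat.cast_one] at A B B'
  have hδ : 1/2 ≤ 1/(y-j) - 1/(y-j+1) := by
    have hd : 0 < y - j := by linarith
    rw [div_sub_div _ _ hd.ne' (by linarith), div_le_div_iff₀ (by norm_num) (by positivity)]
    nlinarith
  rw [abs_of_nonneg (by linarith [A.1, B.1])]
  constructor <;> linarith [A.1, A.2, B.1, B.2]

lemma Dden_eq (n : ℕ) (hn : 0 < n) (x : ℝ) :
    Dden n x = (n/2) * ∑ k ∈ Finset.range (n+1), (-1:ℝ)^k / (n*(x+1)/2 - k) := by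
  have : (0:ℝ) < n := by exact_mod_cast hn
  unfold Dden node
  rw [Finset.mul_sum]
  refine Finset.sum_congr rfl (fun k _ => ?_)
  rw [show x - (2*(k:ℝ)/n - 1) = (2/n) * (n*(x+1)/2 - k) by field_simp; ring]
  rw [div_mul_eq_div_div, ← mul_div_assoc]; congr 1; field_simp

lemma Dden_lower_s2 (n : ℕ) (hn : 0 < n) (x : ℝ) (hx : x ∈ Icc (-1:ℝ) 1) (hnode : ¬ isNode n x) :
    (n:ℝ)/4 ≤ |Dden n x| := by
  have hn' : (0:ℝ) < n := by exact_mod_cast hn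
  set y := (n:ℝ)*(x+1)/2 with hy
  have hxy : ∀ k : ℕ, y = k → x = node n k := by
    intro k hk
    unfold node; rw [← hk, hy]; field_simp; ring
  have hy0 : 0 ≤ y := by rw [hy]; have := hx.1; have : 0 ≤ x + 1 := by linarith
                         positivity
  have hyn : y ≤ n := by rw [hy]; have := hx.2; nlinarith
  have hj0 := Nat.floor_le hy0
  have hj1 := Nat.lt_floor_add_one y
  have hjn : ⌊y⌋₊ < n := by
    have : y ≠ n := fun h => hnode ⟨n, le_rfl, hxy n h⟩
    exact (Nat.floor_lt hy0).2 (lt_of_le_of_ne hyn this)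
  have hj : (⌊y⌋₊ : ℝ) ≠ y := fun h => hnode ⟨_, hjn.le, hxy _ h.symm⟩
  have := (alt_den n _ hjn y (lt_of_le_of_ne hj0 hj) hj1).1
  rw [Dden_eq n hn, abs_mul, abs_of_pos (by positivity)]
  nlinarith

lemma Dden_upper (n j : ℕ) (hj : j < n) (x : ℝ) (hx : (n:ℝ)*(x+1)/2 = j + 1/2) :
    |Dden n x| ≤ 2 * n := by
  have hn : 0 < n := by omega
  have hn' : (0:ℝ) < n := by exact_mod_cast hn
  have := (alt_den n _ hj ((n:ℝ)*(x+1)/2) (by linarith) (by linarith)).2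
  rw [Dden_eq n hn, abs_mul, abs_of_pos (by positivity)]
  rw [hx] at this ⊢
  rw [show (j:ℝ) + 1/2 - j = 1/2 by ring, show (j:ℝ) + 1 - (j+1/2) = 1/2 by ring] at this
  norm_num at this ⊢
  nlinarith
lemma bv_slope (r r' V : ℝ → ℝ)
    (hd : ∀ x ∈ Icc (-1:ℝ) 1, HasDerivWithinAt r (r' x) (Icc (-1:ℝ) 1) x)
    (hVc : Continuous V)
    (hV : ∀ u ∈ Icc (-1:ℝ) 1, ∀ v ∈ Icc (-1:ℝ) 1, u ≤ v → |r' v - r' u| ≤ V v - V u)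
    (x : ℝ) (hx : x ∈ Ioo (-1:ℝ) 1) :
    ∃ Φ : ℝ → ℝ, (∀ a ∈ Icc (-1:ℝ) 1, ∀ b ∈ Icc (-1:ℝ) 1, a ≠ x → b ≠ x → a ≤ b →
      |(r b - r x)/(b - x) - (r a - r x)/(a-x)| ≤ Φ b - Φ a) ∧ Φ 1 - Φ (-1) ≤ V 1 - V (-1) := by
  set W : ℝ → ℝ := fun u => ∫ t in (-1:ℝ)..u, V t with hW
  have hWd : ∀ u, HasDerivAt W (V u) u := fun u => (hVc.integral_hasStrictDerivAt (-1) u).hasDerivAt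
  have hWc : Continuous W := continuous_iff_continuousAt.2 fun u => (hWd u).continuousAt
  have hrc : ContinuousOn r (Icc (-1:ℝ) 1) := fun u hu => (hd u hu).continuousWithinAt
  have hrd : ∀ u ∈ Ioo (-1:ℝ) 1, HasDerivAt r (r' u) u := fun u hu =>
    (hd u (Ioo_subset_Icc_self hu)).hasDerivAt (Icc_mem_nhds hu.1 hu.2)
  have hxI := Ioo_subset_Icc_self hx
  have c1 : ConvexOn ℝ (Icc (-1:ℝ) 1) (fun u => W u + r u) := by
    apply MonotoneOn.convexOn_of_deriv (convex_Icc _ _) (hWc.continuousOn.add hrc)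
    · rw [interior_Icc]
      exact fun u hu => ((hWd u).add (hrd u hu)).differentiableAt.differentiableWithinAt
    · rw [interior_Icc]
      intro u hu v hv huv
      rw [((hWd u).add (hrd u hu)).deriv, ((hWd v).add (hrd v hv)).deriv]
      have := abs_le.1 (hV u (Ioo_subset_Icc_self hu) v (Ioo_subset_Icc_self hv) huv)
      linarith [this.1]
  have c2 : ConvexOn ℝ (Icc (-1:ℝ) 1) (fun u => W u - r u) := by
    apply MonotoneOn.convexOn_of_deriv (convex_Icc _ _) (hWc.continuousOn.sub hrc)
    · rw [interior_Icc]
      exact fun u hu => ((hWd u).sub (hrd u hu)).differentiableAt.differentiableWithinAt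
    · rw [interior_Icc]
      intro u hu v hv huv
      rw [((hWd u).sub (hrd u hu)).deriv, ((hWd v).sub (hrd v hv)).deriv]
      have := abs_le.1 (hV u (Ioo_subset_Icc_self hu) v (Ioo_subset_Icc_self hv) huv)
      linarith [this.2]
  refine ⟨fun t => (W t - W x)/(t - x), ?_, ?_⟩
  · intro a ha b hb hax hbx hab
    have s1 := c1.secant_mono hxI ha hb hax hbx hab
    have s2 := c2.secant_mono hxI ha hb hax hbx hab
    rw [show W a + r a - (W x + r x) = (W a - W x) + (r a - r x) by ring,
      show W b + r b - (W x + r x) = (W b - W x) + (r b - r x) by ring, add_div, add_div] at s1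
    rw [show W a - r a - (W x - r x) = (W a - W x) - (r a - r x) by ring,
      show W b - r b - (W x - r x) = (W b - W x) - (r b - r x) by ring, sub_div (W a - W x), sub_div (W b - W x)] at s2
    beta_reduce
    rw [abs_le]; constructor <;> linarith
  · obtain ⟨c, hc, hce⟩ := exists_hasDerivAt_eq_slope W V hx.2 hWc.continuousOn (fun u _ => hWd u)
    obtain ⟨d, hdd, hde⟩ := exists_hasDerivAt_eq_slope W V hx.1 hWc.continuousOn (fun u _ => hWd u)
    have h1 : V c ≤ V 1 := by
      have := hV c ⟨by linarith [hc.1, hx.1], hc.2.le⟩ 1 (by norm_num) hc.2.le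
      linarith [abs_nonneg (r' 1 - r' c)]
    have h2 : V (-1) ≤ V d := by
      have := hV (-1) (by norm_num) d ⟨hdd.1.le, by linarith [hdd.2, hx.2]⟩ hdd.1.le
      linarith [abs_nonneg (r' d - r' (-1))]
    have e : (W (-1) - W x)/(-1 - x) = (W x - W (-1))/(x - -1) := by
      rw [← neg_div_neg_eq]; congr 1 <;> ring
    simp only []
    rw [e, ← hce, ← hde]; linarith

lemma poly_antideriv (p : Polynomial ℝ) : ∃ P : Polynomial ℝ, Polynomial.derivative P = p := by
  induction p using Polynomial.induction_on' with
  | add p q hp hq =>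
    obtain ⟨P, rfl⟩ := hp
    obtain ⟨Q, rfl⟩ := hq
    exact ⟨P + Q, by simp⟩
  | monomial n a =>
    refine ⟨Polynomial.monomial (n+1) (a/(n+1)), ?_⟩
    rw [Polynomial.derivative_monomial]
    have : (n:ℝ) + 1 ≠ 0 := by positivity
    simp; field_simp

lemma poly_second_diff (s : Polynomial ℝ) : ∃ K : ℝ, 0 ≤ K ∧ ∀ a h : ℝ, 0 < h → -1 ≤ a → a + 2*h ≤ 1 →
    |s.eval a - 2 * s.eval (a+h) + s.eval (a+2*h)| ≤ K * h^2 := by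
  obtain ⟨C, hC⟩ := isCompact_Icc.exists_bound_of_continuousOn (s := Icc (-1:ℝ) 1)
    (f := fun t => s.derivative.derivative.eval t) (Polynomial.continuous _).continuousOn
  have hC0 : 0 ≤ C := (norm_nonneg _).trans (hC 0 (by norm_num))
  refine ⟨2*C, by positivity, fun a h hh ha hb => ?_⟩
  have hd : ∀ (q : Polynomial ℝ) (t : ℝ), HasDerivAt (fun u => q.eval u) (q.derivative.eval t) t :=
    fun q t => q.hasDerivAt t
  obtain ⟨c, hc, hce⟩ := exists_hasDerivAt_eq_slope (fun u => s.eval u) (fun u => s.derivative.eval u)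
    (show a < a + h by linarith) (Polynomial.continuous _).continuousOn (fun u _ => hd _ u)
  obtain ⟨d, hdd, hde⟩ := exists_hasDerivAt_eq_slope (fun u => s.eval u) (fun u => s.derivative.eval u)
    (show a + h < a + 2*h by linarith) (Polynomial.continuous _).continuousOn (fun u _ => hd _ u)
  have hl := Convex.norm_image_sub_le_of_norm_hasDerivWithin_le (s := Icc (-1:ℝ) 1)
    (f := fun u => s.derivative.eval u) (f' := fun u => s.derivative.derivative.eval u) (C := C)
    (fun u _ => (hd s.derivative u).hasDerivWithinAt) hC (convex_Icc _ _)
    (x := c) (y := d) ⟨by linarith [hc.1], by linarith [hc.2]⟩ ⟨by linarith [hdd.1], by linarith [hdd.2]⟩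
  rw [Real.norm_eq_abs, Real.norm_eq_abs, abs_of_pos (show 0 < d - c by linarith [hc.2, hdd.1])] at hl
  rw [eq_div_iff (by linarith)] at hce hde
  have e : s.eval a - 2 * s.eval (a+h) + s.eval (a+2*h) = (s.derivative.eval d - s.derivative.eval c) * h := by
    linarith
  rw [e, abs_mul, abs_of_pos hh]
  have : d - c ≤ 2*h := by linarith [hc.1, hdd.2]
  have := mul_le_mul_of_nonneg_left this hC0
  nlinarith

lemma L1_poly (g : ℝ → ℝ) (hg : IntervalIntegrable g volume (-1) 1) (ε : ℝ) (hε : 0 < ε) :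
    ∃ p : Polynomial ℝ, ∫ t in (-1:ℝ)..1, |g t - p.eval t| ≤ ε := by
  have hg' : Integrable g (volume.restrict (Ioc (-1:ℝ) 1)) := hg.1
  obtain ⟨c, -, hci, hcc, -⟩ := hg'.exists_hasCompactSupport_integral_sub_le (half_pos hε)
  obtain ⟨p, hp⟩ := exists_polynomial_near_of_continuousOn (-1) 1 c hcc.continuousOn (ε/4) (by linarith)
  refine ⟨p, ?_⟩
  have hpc : Continuous fun t => p.eval t := p.continuous
  have i1 : IntervalIntegrable (fun t => |g t - c t|) volume (-1) 1 :=
    (hg.sub (hcc.intervalIntegrable _ _)).abs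
  calc ∫ t in (-1:ℝ)..1, |g t - p.eval t| ≤ ∫ t in (-1:ℝ)..1, (|g t - c t| + ε/4) := by
        apply intervalIntegral.integral_mono_on (by norm_num)
          (hg.sub (hpc.intervalIntegrable _ _)).abs
          (i1.add (by simp))
        intro t ht
        have := hp t ht
        rw [abs_sub_comm] at this
        linarith [abs_sub_le (g t) (c t) (p.eval t)]
    _ = (∫ t in (-1:ℝ)..1, |g t - c t|) + ε/2 := by
        rw [intervalIntegral.integral_add i1 (by simp)]; simp; ring
    _ ≤ ε := by
        rw [intervalIntegral.integral_of_le (by norm_num)]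
        simp only [Real.norm_eq_abs] at hci
        linarith

lemma node_mem (n k : ℕ) (hn : 0 < n) (hk : k ≤ n) : node n k ∈ Icc (-1:ℝ) 1 := by
  have hn' : (0:ℝ) < n := by exact_mod_cast hn
  have hk' : (k:ℝ) ≤ n := by exact_mod_cast hk
  unfold node
  constructor
  · have : 0 ≤ 2*(k:ℝ)/n := by positivity
    linarith
  · have : 2*(k:ℝ)/n ≤ 2 := by rw [div_le_iff₀ hn']; linarith
    linarith
lemma TT_small (f f' g : ℝ → ℝ)
    (hd : ∀ x ∈ Icc (-1:ℝ) 1, HasDerivWithinAt f (f' x) (Icc (-1:ℝ) 1) x)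
    (hg : IntervalIntegrable g volume (-1) 1)
    (hfg : ∀ x ∈ Icc (-1 : ℝ) 1, f' x = f' (-1) + ∫ t in (-1 : ℝ)..x, g t)
    (x : ℝ) (hx : x ∈ Ioo (-1:ℝ) 1) (ε : ℝ) (hε : 0 < ε) :
    ∃ M : ℕ, ∀ m ≥ M, ¬ isNode (2*m) x →
      |TT (fun k => (f (node (2*m) k) - f x) / (node (2*m) k - x)) m| ≤ ε := by
  obtain ⟨p, hp⟩ := L1_poly g hg ε hε
  obtain ⟨P1, hP1⟩ := poly_antideriv p
  obtain ⟨P, hP⟩ := poly_antideriv P1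
  obtain ⟨s, hs⟩ := Polynomial.X_sub_C_dvd_sub_C_eval (a := x) (p := P)
  obtain ⟨K, hK0, hK⟩ := poly_second_diff s
  have hpc : Continuous fun t => p.eval t := p.continuous
  have hsub : ∀ u ∈ Icc (-1:ℝ) 1, ∀ v ∈ Icc (-1:ℝ) 1, uIcc u v ⊆ uIcc (-1:ℝ) 1 := by
    intro u hu v hv
    rw [← uIcc_of_le (show (-1:ℝ) ≤ 1 by norm_num)] at hu hv
    exact uIcc_subset_uIcc hu hv
  have hgi : ∀ u ∈ Icc (-1:ℝ) 1, ∀ v ∈ Icc (-1:ℝ) 1, IntervalIntegrable g volume u v :=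
    fun u hu v hv => hg.mono_set (hsub u hu v hv)
  have hm1 : (-1:ℝ) ∈ Icc (-1:ℝ) 1 := by norm_num
  have h1 : (1:ℝ) ∈ Icc (-1:ℝ) 1 := by norm_num
  set G : ℝ → ℝ := indicator (Ioc (-1:ℝ) 1) (fun t => |g t - p.eval t|) with hG
  have hGint : Integrable G := by
    rw [hG, integrable_indicator_iff measurableSet_Ioc]
    exact (hg.sub (hpc.intervalIntegrable _ _)).abs.1
  have hGi : ∀ a b, IntervalIntegrable G volume a b := fun a b => hGint.intervalIntegrable
  have hGe : ∀ u ∈ Icc (-1:ℝ) 1, ∀ v ∈ Icc (-1:ℝ) 1, u ≤ v →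
      ∫ t in u..v, G t = ∫ t in u..v, |g t - p.eval t| := by
    intro u hu v hv huv
    apply intervalIntegral.integral_congr_ae
    refine Eventually.of_forall fun t ht => ?_
    rw [uIoc_of_le huv] at ht
    rw [hG, indicator_of_mem]
    exact ⟨lt_of_le_of_lt hu.1 ht.1, ht.2.trans hv.2⟩
  obtain ⟨Φ, hΦ1, hΦ2⟩ := bv_slope (fun t => f t - P.eval t) (fun t => f' t - P1.eval t)
    (fun u => ∫ t in (-1:ℝ)..u, G t)
    (fun t ht => (hd t ht).sub (by
      have := P.hasDerivAt t
      rw [hP] at this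
      exact this.hasDerivWithinAt))
    (intervalIntegral.continuous_primitive hGi _)
    (by
      intro u hu v hv huv
      have eV : (∫ t in (-1:ℝ)..v, G t) - (∫ t in (-1:ℝ)..u, G t) = ∫ t in u..v, |g t - p.eval t| := by
        rw [intervalIntegral.integral_interval_sub_left (hGi _ _) (hGi _ _), hGe u hu v hv huv]
      have eg : (∫ t in (-1:ℝ)..v, g t) - (∫ t in (-1:ℝ)..u, g t) = ∫ t in u..v, g t :=
        intervalIntegral.integral_interval_sub_left (hgi _ hm1 _ hv) (hgi _ hm1 _ hu)
      have ep : ∫ t in u..v, p.eval t = P1.eval v - P1.eval u := by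
        apply intervalIntegral.integral_eq_sub_of_hasDerivAt
        · intro t _
          have := P1.hasDerivAt t
          rwa [hP1] at this
        · exact hpc.intervalIntegrable _ _
      have er : (f' v - P1.eval v) - (f' u - P1.eval u) = ∫ t in u..v, (g t - p.eval t) := by
        rw [intervalIntegral.integral_sub (hgi _ hu _ hv) (hpc.intervalIntegrable _ _), ep, ← eg,
          hfg v hv, hfg u hu]; ring
      rw [eV, er]
      simpa only [Real.norm_eq_abs] using intervalIntegral.norm_integral_le_integral_norm
        (μ := volume) (f := fun t => g t - p.eval t) huv)
    x hx
  have hΦ3 : Φ 1 - Φ (-1) ≤ ε := by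
    simp only [intervalIntegral.integral_same, sub_zero] at hΦ2
    rw [hGe _ hm1 _ h1 (by norm_num)] at hΦ2
    linarith
  refine ⟨⌈K/ε⌉₊ + 1, fun m hm hnode => ?_⟩
  have hm0 : 0 < m := by omega
  have hm0' : (0:ℝ) < m := by exact_mod_cast hm0
  have hKm : K ≤ ε * m := by
    have : K/ε ≤ m := (Nat.le_ceil _).trans (by exact_mod_cast (by omega : ⌈K/ε⌉₊ ≤ m))
    rw [div_le_iff₀ hε] at this; linarith
  have hne : ∀ k ≤ 2*m, node (2*m) k ≠ x := fun k hk h => hnode ⟨k, hk, h.symm⟩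
  have hnode_eq : ∀ k, node (2*m) k = k * (1/(m:ℝ)) - 1 := by
    intro k; unfold node; push_cast; field_simp
  have hTT : TT (fun k => (f (node (2*m) k) - f x) / (node (2*m) k - x)) m
      = TT (fun k => ((f (node (2*m) k) - P.eval (node (2*m) k)) - (f x - P.eval x)) / (node (2*m) k - x)) m
        + TT (fun k => s.eval (node (2*m) k)) m := by
    rw [← TT_add]
    have key : ∀ k ≤ 2*m, (f (node (2*m) k) - f x) / (node (2*m) k - x) =
      ((f (node (2*m) k) - P.eval (node (2*m) k)) - (f x - P.eval x)) / (node (2*m) k - x)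
        + s.eval (node (2*m) k) := by
      intro k hk
      have h0 : node (2*m) k - x ≠ 0 := sub_ne_zero.2 (hne k hk)
      have := congrArg (Polynomial.eval (node (2*m) k)) hs
      simp at this
      field_simp
      linarith
    unfold TT
    beta_reduce
    rw [key 0 (by omega), key (2*m) le_rfl]
    congr 1
    refine Finset.sum_congr rfl fun k hk => ?_
    rw [key k (by have := Finset.mem_range.1 hk; omega)]
  rw [hTT]
  have b1 := TT_bv (fun k => ((f (node (2*m) k) - P.eval (node (2*m) k)) - (f x - P.eval x)) / (node (2*m) k - x))
    (fun k => Φ (node (2*m) k)) m (by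
      intro k hk
      apply hΦ1 _ (node_mem _ _ (by omega) (by omega)) _ (node_mem _ _ (by omega) (by omega))
        (hne _ (by omega)) (hne _ (by omega))
      rw [hnode_eq, hnode_eq]
      push_cast
      have : 0 < 1/(m:ℝ) := by positivity
      linarith)
  have b2 := TT_smooth (fun k => s.eval (node (2*m) k)) m (K * (1/(m:ℝ))^2) (by
      intro i hi
      have hh : 0 < 1/(m:ℝ) := by positivity
      have e1 : node (2*m) (2*i+1) = node (2*m) (2*i) + 1/(m:ℝ) := by
        rw [hnode_eq, hnode_eq]; push_cast; ring
      have e2 : node (2*m) (2*i+2) = node (2*m) (2*i) + 2*(1/(m:ℝ)) := by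
        rw [hnode_eq, hnode_eq]; push_cast; ring
      rw [e1, e2]
      apply hK _ _ hh (node_mem _ _ (by omega) (by omega)).1
      rw [← e2]
      exact (node_mem _ _ (by omega) (by omega)).2)
  have n0 : node (2*m) 0 = -1 := by rw [hnode_eq]; simp
  have n1 : node (2*m) (2*m) = 1 := by rw [hnode_eq]; push_cast; field_simp; norm_num
  rw [n0, n1] at b1
  have b3 : (m:ℝ) * (K * (1/(m:ℝ))^2) / 2 ≤ ε/2 := by
    rw [show (m:ℝ) * (K * (1/(m:ℝ))^2) / 2 = (K / m)/2 by field_simp]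
    have : K / m ≤ ε := by rw [div_le_iff₀ hm0']; exact hKm
    linarith
  refine (abs_add_le _ _).trans ?_
  linarith

lemma berrut_sub (f : ℝ → ℝ) (n : ℕ) (hn : 0 < n) (x : ℝ) (hx : x ∈ Icc (-1:ℝ) 1) (h : ¬ isNode n x) :
    berrut f n x - f x = - (∑ k ∈ Finset.range (n+1), (-1:ℝ)^k * ((f (node n k) - f x) / (node n k - x)))
      / Dden n x := by
  have hD : Dden n x ≠ 0 := by
    have := Dden_lower_s2 n hn x hx h
    have hn' : (0:ℝ) < n := by exact_mod_cast hn
    exact abs_pos.1 (lt_of_lt_of_le (by positivity) this)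
  unfold berrut
  rw [if_neg h, eq_div_iff hD, sub_mul, div_mul_cancel₀ _ hD]
  unfold Nnum Dden
  rw [Finset.mul_sum, ← Finset.sum_sub_distrib, ← Finset.sum_neg_distrib]
  refine Finset.sum_congr rfl fun k hk => ?_
  have hk : k ≤ n := by have := Finset.mem_range.1 hk; omega
  have h0 : x - node n k ≠ 0 := sub_ne_zero.2 fun e => h ⟨k, hk, e⟩
  rw [show node n k - x = -(x - node n k) by ring, div_neg]
  field_simp

lemma berrut_bdd (f f' g : ℝ → ℝ)
    (hd : ∀ x ∈ Icc (-1:ℝ) 1, HasDerivWithinAt f (f' x) (Icc (-1:ℝ) 1) x)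
    (hg : IntervalIntegrable g volume (-1) 1)
    (hfg : ∀ x ∈ Icc (-1 : ℝ) 1, f' x = f' (-1) + ∫ t in (-1 : ℝ)..x, g t)
    (n : ℕ) (hn : 0 < n) :
    BddAbove (range fun x : Icc (-1:ℝ) 1 => |berrut f n (x:ℝ) - f (x:ℝ)|) := by
  have hc : ContinuousOn f' (Icc (-1:ℝ) 1) := by
    have : ContinuousOn (fun x => f' (-1) + ∫ t in (-1 : ℝ)..x, g t) (Icc (-1:ℝ) 1) := by
      apply continuousOn_const.add
      have := intervalIntegral.continuousOn_primitive_interval' hg (a := -1) (by simp)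
      rwa [uIcc_of_le (by norm_num)] at this
    exact this.congr hfg
  obtain ⟨C, hC⟩ := isCompact_Icc.exists_bound_of_continuousOn hc
  have hC0 : 0 ≤ C := (norm_nonneg _).trans (hC 0 (by norm_num))
  have hn' : (0:ℝ) < n := by exact_mod_cast hn
  refine ⟨(n+1)*C/(n/4), ?_⟩
  rintro _ ⟨⟨x, hx⟩, rfl⟩
  simp only
  by_cases h : isNode n x
  · unfold berrut
    rw [if_pos h]
    simp; positivity
  · rw [berrut_sub f n hn x hx h, abs_div, abs_neg]
    have hl := Dden_lower_s2 n hn x hx h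
    apply div_le_div₀ (by positivity) _ (by positivity) hl
    refine (Finset.abs_sum_le_sum_abs _ _).trans ?_
    refine (Finset.sum_le_sum (g := fun _ => C) fun k hk => ?_).trans (by simp)
    have hk : k ≤ n := by have := Finset.mem_range.1 hk; omega
    have h0 : 0 < |node n k - x| := abs_pos.2 (sub_ne_zero.2 fun e => h ⟨k, hk, e.symm⟩)
    rw [abs_mul, abs_pow, abs_neg, abs_one, one_pow, one_mul, abs_div, div_le_iff₀ h0]
    exact Convex.norm_image_sub_le_of_norm_hasDerivWithin_le hd hC (convex_Icc _ _) hx (node_mem _ _ hn hk)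

lemma key_eq (f f' g : ℝ → ℝ)
    (hd : ∀ x ∈ Icc (-1:ℝ) 1, HasDerivWithinAt f (f' x) (Icc (-1:ℝ) 1) x)
    (hg : IntervalIntegrable g volume (-1) 1)
    (hfg : ∀ x ∈ Icc (-1 : ℝ) 1, f' x = f' (-1) + ∫ t in (-1 : ℝ)..x, g t)
    (hT : Filter.Tendsto
      (fun j : ℕ => ((2 * (j + 1) : ℕ) : ℝ) *
        ⨆ x : Set.Icc (-1 : ℝ) 1, |berrut f (2 * (j + 1)) (x : ℝ) - f (x : ℝ)|)
      Filter.atTop (nhds 0))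
    (Q : ℕ) (hQ : 0 < Q) (i : ℕ) (hi : i < 2 * Q) (x : ℝ) (hx : x = (2*i+1)/(2*Q) - 1) :
    (f 1 - f x) / (1 - x) + (f (-1) - f x) / (-1 - x) = 0 := by
  have hQ' : (0:ℝ) < Q := by exact_mod_cast hQ
  have hi' : (i:ℝ) + 1 ≤ 2 * Q := by exact_mod_cast hi
  have hxI : x ∈ Ioo (-1:ℝ) 1 := by
    rw [hx]; constructor
    · have : 0 < (2*(i:ℝ)+1)/(2*Q) := by positivity
      linarith
    · have : (2*(i:ℝ)+1)/(2*Q) < 2 := by rw [div_lt_iff₀ (by positivity)]; linarith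
      linarith
  set A := (f 1 - f x) / (1 - x) + (f (-1) - f x) / (-1 - x) with hA
  by_contra hne
  have hpos : 0 < |A| := abs_pos.2 hne
  obtain ⟨M, hM⟩ := TT_small f f' g hd hg hfg x hxI (|A|/8) (by positivity)
  obtain ⟨J, hJ⟩ := (Metric.tendsto_atTop.1 hT) (|A|/8) (by positivity)
  -- choose odd multiple
  set N := M + J + 1 with hN
  set m := Q * (2*N+1) with hm
  have hmN : N ≤ m := by rw [hm]; nlinarith
  obtain ⟨j, hj⟩ : ∃ j, m = j + 1 := ⟨m - 1, by omega⟩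
  have hm0 : 0 < m := by omega
  have hm0' : (0:ℝ) < m := by exact_mod_cast hm0
  -- half-integer
  obtain ⟨l, hl⟩ : ∃ l : ℕ, (2*N+1) * (2*i+1) = 2*l+1 := ⟨2*N*i+N+i, by ring⟩
  have hmR : (m:ℝ) = Q * (2*N+1) := by rw [hm]; push_cast; ring
  have hlR : (2*(N:ℝ)+1) * (2*i+1) = 2*l+1 := by exact_mod_cast hl
  have hy : ((2*m : ℕ):ℝ) * (x+1)/2 = l + 1/2 := by
    rw [hx]; push_cast; rw [hmR]; field_simp; linarith
  have hlm : l < 2*m := by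
    have h2 : ((2*m : ℕ):ℝ) * (x+1)/2 < 2*m := by push_cast; nlinarith [hxI.2]
    rw [hy] at h2
    have : (l:ℝ) < (2*m : ℕ) := by push_cast; linarith
    exact_mod_cast this
  have hnode : ¬ isNode (2*m) x := by
    rintro ⟨k, -, hk⟩
    rw [hk] at hy
    have : ((2*m : ℕ):ℝ) * (node (2*m) k+1)/2 = k := by unfold node; push_cast; field_simp; ring
    rw [this] at hy
    have h3 : (2*k : ℝ) = 2*l+1 := by linarith
    have h4 : 2*k = 2*l+1 := by exact_mod_cast h3
    omega
  have hxI' := Ioo_subset_Icc_self hxI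
  have hup := Dden_upper (2*m) l hlm x hy
  have hDpos : 0 < |Dden (2*m) x| := by
    have := Dden_lower_s2 (2*m) (by omega) x hxI' hnode
    refine lt_of_lt_of_le ?_ this
    push_cast; positivity
  have hTT := hM m (by omega) hnode
  have hsup := hJ j (by omega)
  rw [← hj, Real.dist_eq, sub_zero] at hsup
  have hle := le_ciSup (berrut_bdd f f' g hd hg hfg (2*m) (by omega)) ⟨x, hxI'⟩
  simp only at hle
  have h5 : ((2*m:ℕ):ℝ) * |berrut f (2*m) x - f x| < |A|/8 := by
    refine lt_of_le_of_lt (mul_le_mul_of_nonneg_left hle (by positivity)) ?_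
    exact (le_abs_self _).trans_lt hsup
  rw [berrut_sub f (2*m) (by omega) x hxI' hnode, abs_div, abs_neg] at h5
  set S := ∑ k ∈ Finset.range (2*m+1), (-1:ℝ)^k * ((f (node (2*m) k) - f x) / (node (2*m) k - x)) with hS
  have n0 : node (2*m) 0 = -1 := by unfold node; simp
  have n1 : node (2*m) (2*m) = 1 := by unfold node; push_cast; field_simp; norm_num
  have h6 : TT (fun k => (f (node (2*m) k) - f x) / (node (2*m) k - x)) m = S - A/2 := by
    unfold TT
    beta_reduce
    rw [n0, n1, hA, hS]; ring
  rw [h6] at hTT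
  have h7 : |S| < |A|/4 := by
    rw [← mul_div_assoc, div_lt_iff₀ hDpos] at h5
    have hm2 : (0:ℝ) < (2*m:ℕ) := by push_cast; positivity
    have : |A|/8 * |Dden (2*m) x| ≤ |A|/8 * (2 * (2*m:ℕ)) := mul_le_mul_of_nonneg_left hup (by positivity)
    have : ((2*m:ℕ):ℝ) * |S| < ((2*m:ℕ):ℝ) * (|A|/4) := by linarith
    exact lt_of_mul_lt_mul_left this hm2.le
  have h8 : |A/2| ≤ |S - A/2| + |S| := by
    have := abs_sub_abs_le_abs_sub (A/2) S
    rw [abs_sub_comm] at this; linarith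
  rw [abs_div, abs_of_pos (by norm_num : (0:ℝ) < 2)] at h8
  linarith
/-- for `f ∈ AC¹`, `n ‖B_n f - f‖_∞ → 0` along even `n` iff `f` is constant. -/
theorem statement2 (f : ℝ → ℝ) (hf : AC1 f) :
    Filter.Tendsto
      (fun j : ℕ => ((2 * (j + 1) : ℕ) : ℝ) *
        ⨆ x : Set.Icc (-1 : ℝ) 1, |berrut f (2 * (j + 1)) (x : ℝ) - f (x : ℝ)|)
      Filter.atTop (nhds 0) ↔
    ∀ x ∈ Set.Icc (-1 : ℝ) 1, ∀ y ∈ Set.Icc (-1 : ℝ) 1, f x = f y := by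
  obtain ⟨f', hd, g, hg, hfg⟩ := hf
  constructor
  · intro hT
    have hfc : ContinuousOn f (Icc (-1:ℝ) 1) := fun u hu => (hd u hu).continuousWithinAt
    have main : ∀ x ∈ Ico (-1:ℝ) 1, f x * (2*x) = f 1 * (x+1) + f (-1) * (x-1) := by
      intro x hx
      set u : ℕ → ℝ := fun Q => (2*(⌊((Q+1:ℕ):ℝ) * (x+1)⌋₊:ℝ)+1)/(2*((Q+1:ℕ):ℝ)) - 1 with hu
      have hx1 : 0 ≤ x + 1 := by linarith [hx.1]
      have hfl : ∀ Q : ℕ, ⌊((Q+1:ℕ):ℝ) * (x+1)⌋₊ < 2 * (Q+1) := by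
        intro Q
        rw [Nat.floor_lt (by positivity)]
        push_cast
        have : (0:ℝ) < Q + 1 := by positivity
        nlinarith [hx.2]
      have humem : ∀ Q, u Q ∈ Ioo (-1:ℝ) 1 := by
        intro Q
        have h2 : ((⌊((Q+1:ℕ):ℝ) * (x+1)⌋₊:ℕ):ℝ) + 1 ≤ 2 * ((Q+1:ℕ):ℝ) := by exact_mod_cast hfl Q
        have hQ : (0:ℝ) < ((Q+1:ℕ):ℝ) := by positivity
        simp only [hu]
        constructor
        · have : 0 < (2*(⌊((Q+1:ℕ):ℝ) * (x+1)⌋₊:ℝ)+1)/(2*((Q+1:ℕ):ℝ)) := by positivity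
          linarith
        · have : (2*(⌊((Q+1:ℕ):ℝ) * (x+1)⌋₊:ℝ)+1)/(2*((Q+1:ℕ):ℝ)) < 2 := by
            rw [div_lt_iff₀ (by positivity)]; linarith
          linarith
      have hut : Tendsto u atTop (nhds x) := by
        rw [tendsto_iff_norm_sub_tendsto_zero]
        refine squeeze_zero (fun _ => norm_nonneg _) (fun Q => ?_) tendsto_one_div_add_atTop_nhds_zero_nat
        have hQ : (0:ℝ) < ((Q+1:ℕ):ℝ) := by positivity
        have f1 := Nat.floor_le (show 0 ≤ ((Q+1:ℕ):ℝ) * (x+1) by positivity)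
        have f2 := Nat.lt_floor_add_one (((Q+1:ℕ):ℝ) * (x+1))
        have e : u Q - x = (2*(⌊((Q+1:ℕ):ℝ) * (x+1)⌋₊:ℝ)+1 - 2 * (((Q+1:ℕ):ℝ) * (x+1)))/(2*((Q+1:ℕ):ℝ)) := by
          simp only [hu]; field_simp; ring
        rw [e, Real.norm_eq_abs, abs_div, abs_of_pos (show 0 < 2*((Q+1:ℕ):ℝ) by positivity),
          show (Q:ℝ) + 1 = ((Q+1:ℕ):ℝ) by push_cast; ring, div_le_div_iff₀ (by positivity) hQ]
        have : |2*(⌊((Q+1:ℕ):ℝ) * (x+1)⌋₊:ℝ)+1 - 2 * (((Q+1:ℕ):ℝ) * (x+1))| ≤ 1 := by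
          rw [abs_le]; constructor <;> linarith
        nlinarith
      have heq : ∀ Q, f (u Q) * (2*u Q) = f 1 * (u Q+1) + f (-1) * (u Q-1) := by
        intro Q
        have := key_eq f f' g hd hg hfg hT (Q+1) (by omega) _ (hfl Q) (u Q) rfl
        have h1 : 1 - u Q ≠ 0 := by linarith [(humem Q).2]
        have h2 : -1 - u Q ≠ 0 := by linarith [(humem Q).1]
        rw [div_add_div _ _ h1 h2, div_eq_zero_iff] at this
        rcases this with h | h
        · linarith
        · exact absurd h (mul_ne_zero h1 h2)
      have hfu : Tendsto (fun Q => f (u Q)) atTop (nhds (f x)) :=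
        (hfc x (Ico_subset_Icc_self hx)).tendsto.comp
          (tendsto_nhdsWithin_iff.2 ⟨hut, Eventually.of_forall fun Q => Ioo_subset_Icc_self (humem Q)⟩)
      have t1 := hfu.mul (hut.const_mul 2)
      have t2 := ((hut.add_const 1).const_mul (f 1)).add ((hut.sub_const 1).const_mul (f (-1)))
      exact tendsto_nhds_unique t1 (t2.congr fun Q => (heq Q).symm)
    have h0 := main 0 (by norm_num)
    have h11 : f 1 = f (-1) := by linarith
    have hcon : ∀ x ∈ Icc (-1:ℝ) 1, x ≠ 0 → f x = f 1 := by
      intro x hx hx0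
      rcases eq_or_lt_of_le hx.2 with h | h
      · rw [h]
      · have := main x ⟨hx.1, h⟩
        rw [← h11] at this
        have h2 : (2*x) * (f x - f 1) = 0 := by linarith
        rcases mul_eq_zero.1 h2 with h3 | h3
        · exact absurd h3 (by simpa using hx0)
        · linarith
    have hz : f 0 = f 1 := by
      have hu : Tendsto (fun n : ℕ => 1/((n:ℝ)+1)) atTop (nhds 0) := tendsto_one_div_add_atTop_nhds_zero_nat
      have hmem : ∀ n : ℕ, 1/((n:ℝ)+1) ∈ Icc (-1:ℝ) 1 := by
        intro n
        have : 0 < 1/((n:ℝ)+1) := by positivity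
        refine ⟨by linarith, ?_⟩
        rw [div_le_one (by positivity)]; linarith [(Nat.cast_nonneg n : (0:ℝ) ≤ n)]
      have hfu : Tendsto (fun n : ℕ => f (1/((n:ℝ)+1))) atTop (nhds (f 0)) :=
        (hfc 0 (by norm_num)).tendsto.comp
          (tendsto_nhdsWithin_iff.2 ⟨hu, Eventually.of_forall hmem⟩)
      refine tendsto_nhds_unique hfu (tendsto_const_nhds.congr fun n => ?_)
      exact (hcon _ (hmem n) (by positivity)).symm
    have hcon' : ∀ x ∈ Icc (-1:ℝ) 1, f x = f 1 := by
      intro x hx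
      by_cases h : x = 0
      · rw [h, hz]
      · exact hcon x hx h
    intro x hx y hy
    rw [hcon' x hx, hcon' y hy]
  · intro hc
    have : ∀ j : ℕ, ∀ x : Icc (-1:ℝ) 1, |berrut f (2 * (j + 1)) (x : ℝ) - f (x : ℝ)| = 0 := by
      rintro j ⟨x, hx⟩
      simp only
      by_cases h : isNode (2*(j+1)) x
      · unfold berrut; rw [if_pos h]; simp
      · rw [berrut_sub f _ (by omega) x hx h, Finset.sum_eq_zero]
        · simp
        · intro k hk
          have hk : k ≤ 2*(j+1) := by have := Finset.mem_range.1 hk; omega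
          rw [hc _ (node_mem _ k (by omega) hk) x hx]; simp
    simp [this]
end

section
/- Let f ∈ AC¹ and let x ∈ (−1,1) be irrational. For every real number L with |L| ≤ 2|O(f,x)|/π there exists a strictly increasing sequence (n_j) of odd positive integers such that n_j (B_{n_j}(f,x) − f(x)) → L as j → ∞. -/
open Filter Set MeasureTheory

lemma alt_aux (r : ℕ) : ∀ d : ℕ → ℝ, Antitone d → (∀ k, 0 ≤ d k) →
    0 ≤ ∑ i ∈ Finset.range r, (-1 : ℝ) ^ i * d i ∧
      ∑ i ∈ Finset.range r, (-1 : ℝ) ^ i * d i ≤ d 0 := by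
  induction r with
  | zero => intro d _ h; simpa using h 0
  | succ r ih =>
    intro d hd h
    have := ih (fun k => d (k + 1)) (fun a b hab => hd (by omega)) (fun k => h _)
    have h1 := hd (Nat.zero_le 1)
    have e : ∑ i ∈ Finset.range (r + 1), (-1 : ℝ) ^ i * d i
        = d 0 - ∑ i ∈ Finset.range r, (-1 : ℝ) ^ i * d (i + 1) := by
      rw [Finset.sum_range_succ', sub_eq_add_neg, add_comm, ← Finset.sum_neg_distrib]
      congr 1
      · simp
      · exact Finset.sum_congr rfl fun i _ => by ring
    rw [e]
    simp only [zero_add] at this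
    constructor <;> linarith [this.1, this.2]

/-- kernel -/
noncomputable def kap (d v : ℝ) : ℝ := if 0 < v ∧ v ≤ d then 1 - v / d else 0

lemma kap_mem (d v : ℝ) : 0 ≤ kap d v ∧ kap d v ≤ 1 := by
  unfold kap
  split_ifs with h
  · have hd : 0 < d := h.1.trans_le h.2
    have := (div_le_one hd).2 h.2
    have := div_pos h.1 hd
    constructor <;> linarith
  · norm_num

lemma kap_mono {d d' v : ℝ} (h : d ≤ d') : kap d v ≤ kap d' v := by
  by_cases h1 : 0 < v ∧ v ≤ d
  · have h2 : 0 < v ∧ v ≤ d' := ⟨h1.1, h1.2.trans h⟩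
    have hd : 0 < d := h1.1.trans_le h1.2
    simp only [kap, h1, h2, and_self, if_true]
    have : v / d' ≤ v / d := by
      apply div_le_div_of_nonneg_left h1.1.le hd h
    linarith
  · have : kap d v = 0 := by simp [kap, h1]
    rw [this]; exact (kap_mem _ _).1

lemma kap_ge {d v : ℝ} (hv : 0 < v) (h : v ≤ d) : kap d v = 1 - v / d := by simp [kap, hv, h]

lemma kap_lip {d δ v : ℝ} (hv : 0 < v) (hδ : 0 < δ) : kap (d + δ) v - kap d v ≤ δ / v := by
  by_cases h : v ≤ d
  · rw [kap_ge hv h, kap_ge hv (by linarith)]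
    have hd : 0 < d := by linarith
    have : 1 - v / (d + δ) - (1 - v / d) = (v / d) * (δ / (d + δ)) := by
      field_simp; ring
    rw [this]
    have h1 : v / d ≤ 1 := (div_le_one hd).2 h
    have h2 : δ / (d + δ) ≤ δ / v := div_le_div_of_nonneg_left hδ.le hv (by linarith)
    have h3 : 0 ≤ δ / (d + δ) := by positivity
    nlinarith
  · have e : kap d v = 0 := by simp [kap, h]
    rw [e]
    by_cases h' : v ≤ d + δ
    · rw [kap_ge hv h']
      have hd : 0 < d + δ := by linarith
      have : 1 - v / (d + δ) = (d + δ - v) / (d + δ) := by field_simp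
      rw [this, sub_zero]
      exact div_le_div₀ hδ.le (by linarith) hv h'
    · have e : kap (d + δ) v = 0 := by simp [kap, h']
      rw [e]; simp; positivity

lemma kap_alt_ge (N : ℕ) {a δ v : ℝ} (hv : 0 < v) (hδ : 0 < δ) (ha : v ≤ a) :
    0 ≤ ∑ k ∈ Finset.range N, (-1 : ℝ) ^ k * (kap (a + k * δ + δ) v - kap (a + k * δ) v) ∧
    ∑ k ∈ Finset.range N, (-1 : ℝ) ^ k * (kap (a + k * δ + δ) v - kap (a + k * δ) v)
      ≤ kap (a + δ) v - kap a v := by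
  have := alt_aux N (fun k => kap (a + k * δ + δ) v - kap (a + k * δ) v) ?_ ?_
  · simpa using this
  · apply antitone_nat_of_succ_le
    intro k
    have hk : 0 ≤ (k : ℝ) * δ := by positivity
    set b := a + k * δ with hb
    have e1 : a + ((k + 1 : ℕ) : ℝ) * δ = b + δ := by push_cast; rw [hb]; ring
    rw [e1, kap_ge hv (by linarith), kap_ge hv (by linarith), kap_ge hv (by linarith)]
    have hb0 : 0 < b := by linarith
    have : (1 - v / (b + δ) - (1 - v / b)) - (1 - v / (b + δ + δ) - (1 - v / (b + δ)))
      = v * (2 * δ ^ 2) / (b * (b + δ) * (b + δ + δ)) := by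
      field_simp; ring
    have h2 : 0 ≤ v * (2 * δ ^ 2) / (b * (b + δ) * (b + δ + δ)) := by positivity
    linarith
  · intro k
    have := kap_mono (v := v) (d := a + k * δ) (d' := a + k * δ + δ) (by linarith)
    linarith

lemma kap_alt_small (N : ℕ) {δ v : ℝ} (hv : 0 < v) (hδ : 0 < δ) : ∀ a : ℝ,
    |∑ k ∈ Finset.range N, (-1 : ℝ) ^ k * (kap (a + k * δ + δ) v - kap (a + k * δ) v)|
      ≤ δ / v := by
  induction N with
  | zero => intro a; simp; positivity
  | succ N ih =>
    intro a
    have e : ∑ k ∈ Finset.range (N + 1), (-1 : ℝ) ^ k * (kap (a + k * δ + δ) v - kap (a + k * δ) v)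
        = (kap (a + δ) v - kap a v) - ∑ k ∈ Finset.range N, (-1 : ℝ) ^ k *
          (kap ((a + δ) + k * δ + δ) v - kap ((a + δ) + k * δ) v) := by
      rw [Finset.sum_range_succ', sub_eq_add_neg _ (∑ k ∈ Finset.range N, _), add_comm,
        ← Finset.sum_neg_distrib]
      congr 1
      · simp
      · refine Finset.sum_congr rfl fun i _ => ?_
        have : a + ((i + 1 : ℕ) : ℝ) * δ = a + δ + i * δ := by push_cast; ring
        rw [this]; ring
    rw [e]
    have l0 := kap_lip (d := a) hv hδ
    have l1 := kap_lip (d := a + δ) hv hδ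
    have m0 := kap_mono (v := v) (d := a) (d' := a + δ) (by linarith)
    by_cases h : v ≤ a + δ
    · have := kap_alt_ge N hv hδ h
      rw [abs_le]; constructor <;> linarith [this.1, this.2]
    · have e1 : kap (a + δ) v = 0 := by simp [kap, h]
      have e2 : kap a v = 0 := by
        have h' : ¬ v ≤ a := by intro h'; apply h; linarith
        simp [kap, h']
      have := ih (a + δ)
      rw [e1, e2, sub_zero, zero_sub, abs_neg]
      exact this

lemma kap_alt_one (N : ℕ) {a δ v : ℝ} (hδ : 0 < δ) :
    |∑ k ∈ Finset.range N, (-1 : ℝ) ^ k * (kap (a + k * δ + δ) v - kap (a + k * δ) v)| ≤ 1 := by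
  refine (Finset.abs_sum_le_sum_abs _ _).trans ?_
  have : ∀ k ∈ Finset.range N, |(-1 : ℝ) ^ k * (kap (a + k * δ + δ) v - kap (a + k * δ) v)|
      = kap (a + (k + 1 : ℕ) * δ) v - kap (a + k * δ) v := by
    intro k _
    have m0 := kap_mono (v := v) (d := a + k * δ) (d' := a + k * δ + δ) (by linarith)
    rw [abs_mul, abs_pow, abs_neg, abs_one, one_pow, one_mul, abs_of_nonneg (by linarith)]
    congr 2; push_cast; ring
  rw [Finset.sum_congr rfl this, Finset.sum_range_sub (fun k : ℕ => kap (a + k * δ) v)]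
  linarith [(kap_mem (a + N * δ) v).2, (kap_mem (a + (0 : ℕ) * δ) v).1]

/-- full kernel -/
noncomputable def Ker (x t u : ℝ) : ℝ := kap (t - x) (u - x) - kap (x - t) (x - u)

lemma reflect_abs (n : ℕ) (h : ℕ → ℝ) :
    |∑ k ∈ Finset.range n, (-1 : ℝ) ^ k * h (n - 1 - k)| = |∑ k ∈ Finset.range n, (-1 : ℝ) ^ k * h k| := by
  rw [← Finset.sum_range_reflect]
  have : ∑ j ∈ Finset.range n, (-1 : ℝ) ^ (n - 1 - j) * h (n - 1 - (n - 1 - j))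
     = (-1) ^ (n - 1) * ∑ j ∈ Finset.range n, (-1 : ℝ) ^ j * h j := by
    rw [Finset.mul_sum]
    refine Finset.sum_congr rfl fun j hj => ?_
    have hj := Finset.mem_range.1 hj
    obtain ⟨m, hm⟩ : ∃ m, n - 1 = j + m := ⟨n - 1 - j, by omega⟩
    rw [hm]
    have : j + m - (j + m - j) = j := by omega
    rw [this, Nat.add_sub_cancel_left, pow_add]
    have : (-1 : ℝ) ^ j * (-1) ^ j = 1 := by rw [← mul_pow]; simp
    linear_combination (-1 : ℝ) ^ m * h j * (-this)
  rw [this, abs_mul, abs_pow]; simp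

/-- alternating sum of increments -/
noncomputable def Talt (n : ℕ) (h : ℝ → ℝ) : ℝ :=
  ∑ k ∈ Finset.range n, (-1 : ℝ) ^ k * (h (2 * ((k + 1 : ℕ) : ℝ) / n - 1) - h (2 * (k : ℝ) / n - 1))

lemma Talt_split (n : ℕ) (hn : 0 < n) (x u : ℝ) : ∃ b1 b2 : ℝ,
    |Talt n (fun t => Ker x t u)| ≤
    |∑ k ∈ Finset.range n, (-1 : ℝ) ^ k * (kap (b1 + k * (2 / n) + 2 / n) (u - x) - kap (b1 + k * (2 / n)) (u - x))|
   + |∑ k ∈ Finset.range n, (-1 : ℝ) ^ k * (kap (b2 + k * (2 / n) + 2 / n) (x - u) - kap (b2 + k * (2 / n)) (x - u))| := by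
  refine ⟨-1 - x, x - 1, ?_⟩
  have hn' : (n : ℝ) ≠ 0 := by positivity
  have e : Talt n (fun t => Ker x t u) =
    ∑ k ∈ Finset.range n, (-1 : ℝ) ^ k * (kap (-1 - x + k * (2 / n) + 2 / n) (u - x) - kap (-1 - x + k * (2 / n)) (u - x))
    + ∑ k ∈ Finset.range n, (-1 : ℝ) ^ k * (fun j : ℕ => kap (x - 1 + j * (2 / n) + 2 / n) (x - u) - kap (x - 1 + j * (2 / n)) (x - u)) (n - 1 - k) := by
    rw [Talt, ← Finset.sum_add_distrib]
    refine Finset.sum_congr rfl fun k hk => ?_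
    have hk := Finset.mem_range.1 hk
    rw [← mul_add]
    congr 1
    simp only [Ker]
    have c : ((n - 1 - k : ℕ) : ℝ) = n - 1 - k := by
      rw [Nat.cast_sub (by omega), Nat.cast_sub (by omega)]; simp
    rw [c]
    have e1 : 2 * ((k + 1 : ℕ) : ℝ) / n - 1 - x = -1 - x + k * (2 / n) + 2 / n := by
      push_cast; ring
    have e2 : 2 * (k : ℝ) / n - 1 - x = -1 - x + k * (2 / n) := by ring
    have e3 : x - (2 * ((k + 1 : ℕ) : ℝ) / n - 1) = x - 1 + (n - 1 - k) * (2 / n) := by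
      push_cast; field_simp; ring
    have e4 : x - (2 * (k : ℝ) / n - 1) = x - 1 + (n - 1 - k) * (2 / n) + 2 / n := by
      field_simp; ring
    rw [e1, e2, e3, e4]; ring
  rw [e]
  refine (abs_add_le _ _).trans ?_
  exact le_of_eq (congrArg _ (reflect_abs n (fun j : ℕ => kap (x - 1 + j * (2 / n) + 2 / n) (x - u) - kap (x - 1 + j * (2 / n)) (x - u))))

lemma Talt_two (n : ℕ) (hn : 0 < n) (x u : ℝ) : |Talt n (fun t => Ker x t u)| ≤ 2 := by
  obtain ⟨b1, b2, h⟩ := Talt_split n hn x u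
  have := kap_alt_one n (a := b1) (δ := 2 / n) (v := u - x) (by positivity)
  have := kap_alt_one n (a := b2) (δ := 2 / n) (v := x - u) (by positivity)
  linarith

lemma kap_zero {d v : ℝ} (hv : v ≤ 0) : kap d v = 0 := by simp [kap, not_lt.2 hv]

lemma Talt_small (n : ℕ) (hn : 0 < n) (x u : ℝ) (hu : u ≠ x) :
    |Talt n (fun t => Ker x t u)| ≤ 2 / n / |u - x| := by
  obtain ⟨b1, b2, h⟩ := Talt_split n hn x u
  have hδ : (0 : ℝ) < 2 / n := by positivity
  rcases lt_or_gt_of_ne hu with hu | hu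
  · have := kap_alt_small n (δ := 2 / n) (v := x - u) (by linarith) hδ b2
    have z : ∀ d, kap d (u - x) = 0 := fun d => kap_zero (by linarith)
    simp only [z, sub_self, mul_zero, Finset.sum_const_zero, abs_zero, zero_add] at h
    rw [abs_of_neg (show u - x < 0 by linarith), neg_sub]
    linarith
  · have := kap_alt_small n (δ := 2 / n) (v := u - x) (by linarith) hδ b1
    have z : ∀ d, kap d (x - u) = 0 := fun d => kap_zero (by linarith)
    simp only [z, sub_self, mul_zero, Finset.sum_const_zero, abs_zero, add_zero] at h
    rw [abs_of_pos (show 0 < u - x by linarith)]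
    linarith

lemma Ker_meas (x t : ℝ) : Measurable (fun u => Ker x t u) := by
  unfold Ker kap
  refine Measurable.sub ?_ ?_ <;> refine Measurable.ite ?_ (by fun_prop) (by fun_prop)
  · exact (measurableSet_lt (f := fun _ : ℝ => (0 : ℝ)) (g := fun u => u - x) (by fun_prop) (by fun_prop)).inter
      (measurableSet_le (f := fun u => u - x) (g := fun _ => t - x) (by fun_prop) (by fun_prop))
  · exact (measurableSet_lt (f := fun _ : ℝ => (0 : ℝ)) (g := fun u => x - u) (by fun_prop) (by fun_prop)).inter
      (measurableSet_le (f := fun u => x - u) (g := fun _ => x - t) (by fun_prop) (by fun_prop))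

lemma Ker_bdd (x t u : ℝ) : |Ker x t u| ≤ 1 := by
  unfold Ker
  have := kap_mem (t - x) (u - x)
  have := kap_mem (x - t) (x - u)
  rw [abs_le]; constructor <;> linarith

lemma Ker_int (x t : ℝ) (g : ℝ → ℝ) (hg : IntervalIntegrable g volume (-1) 1) :
    IntervalIntegrable (fun u => Ker x t u * g u) volume (-1) 1 := by
  rw [intervalIntegrable_iff] at *
  refine Integrable.bdd_mul (c := 1) hg (Ker_meas x t).aestronglyMeasurable ?_
  exact Eventually.of_forall fun u => by simpa using Ker_bdd x t u

lemma Talt_tendsto (x : ℝ) (g φ : ℝ → ℝ) (c : ℝ) (hg : IntervalIntegrable g volume (-1) 1)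
    (hφ : ∀ n k : ℕ, 0 < n → k ≤ n → φ (2 * k / n - 1) = c + ∫ u in (-1 : ℝ)..1, Ker x (2 * k / n - 1) u * g u) :
    Tendsto (fun n : ℕ => Talt n φ) atTop (nhds 0) := by
  have e : ∀ n : ℕ, 0 < n → Talt n φ = ∫ u in (-1 : ℝ)..1, Talt n (fun t => Ker x t u) * g u := by
    intro n hn
    unfold Talt
    simp_rw [Finset.sum_mul]
    rw [intervalIntegral.integral_finsetSum]
    · refine Finset.sum_congr rfl fun k hk => ?_
      have hk := Finset.mem_range.1 hk
      rw [hφ n (k + 1) hn (by omega), hφ n k hn (by omega)]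
      simp_rw [mul_assoc, sub_mul]
      rw [intervalIntegral.integral_const_mul, intervalIntegral.integral_sub]
      · ring
      · exact Ker_int x _ g hg
      · exact Ker_int x _ g hg
    · intro k _
      simp_rw [mul_assoc, sub_mul]
      exact ((Ker_int x _ g hg).sub (Ker_int x _ g hg)).const_mul _
  have lim : Tendsto (fun n : ℕ => ∫ u in (-1 : ℝ)..1, Talt n (fun t => Ker x t u) * g u) atTop
      (nhds (∫ u in (-1 : ℝ)..1, (0 : ℝ))) := by
    apply intervalIntegral.tendsto_integral_filter_of_dominated_convergence (fun u => 2 * |g u|)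
    · refine Eventually.of_forall fun n => ?_
      refine AEStronglyMeasurable.mul (Measurable.aestronglyMeasurable ?_) ?_
      · unfold Talt
        exact Finset.measurable_sum _ fun k _ => ((Ker_meas x _).sub (Ker_meas x _)).const_mul _
      · exact (intervalIntegrable_iff.1 hg).aestronglyMeasurable
    · filter_upwards [eventually_gt_atTop 0] with n hn
      refine Eventually.of_forall fun u _ => ?_
      rw [Real.norm_eq_abs, abs_mul]
      exact mul_le_mul_of_nonneg_right (Talt_two n hn x u) (abs_nonneg _)
    · exact hg.abs.const_mul 2
    · have : ∀ᵐ u : ℝ, u ≠ x := by simp [ae_iff]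
      filter_upwards [this] with u hu _
      have h0 : Tendsto (fun n : ℕ => Talt n (fun t => Ker x t u)) atTop (nhds 0) := by
        have h1 : Tendsto (fun n : ℕ => 2 / (n : ℝ) / |u - x|) atTop (nhds 0) := by
          simpa using (tendsto_const_div_atTop_nhds_zero_nat 2).div_const |u - x|
        apply squeeze_zero_norm' _ h1
        filter_upwards [eventually_gt_atTop 0] with n hn
        exact Talt_small n hn x u hu
      simpa using h0.mul_const (g u)
  rw [intervalIntegral.integral_zero] at lim
  refine lim.congr' ?_
  filter_upwards [eventually_gt_atTop 0] with n hn
  rw [e n hn]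

lemma Ker_gt {x t : ℝ} (h : x < t) (u : ℝ) :
    Ker x t u = (Ioc x t).indicator (fun u => (t - u) / (t - x)) u := by
  have e2 : kap (x - t) (x - u) = 0 := by
    unfold kap; rw [if_neg]; rintro ⟨h1, h2⟩; linarith
  rw [Ker, e2, sub_zero, indicator_apply, kap]
  have : (0 < u - x ∧ u - x ≤ t - x) ↔ u ∈ Ioc x t := by
    constructor
    · rintro ⟨a, b⟩; exact ⟨by linarith, by linarith⟩
    · rintro ⟨a, b⟩; exact ⟨by linarith, by linarith⟩
  simp only [this]
  split_ifs
  · have : t - x ≠ 0 := by linarith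
    field_simp; ring
  · rfl

lemma Ker_lt {x t : ℝ} (h : t < x) (u : ℝ) :
    Ker x t u = (Ioo t x).indicator (fun u => (t - u) / (x - t)) u := by
  have e2 : kap (t - x) (u - x) = 0 := by
    unfold kap; rw [if_neg]; rintro ⟨h1, h2⟩; linarith
  have hne : x - t ≠ 0 := by linarith
  rw [Ker, e2, zero_sub, indicator_apply, kap]
  by_cases hu : u ∈ Ioo t x
  · rw [if_pos ⟨by linarith [hu.2], by linarith [hu.1]⟩, if_pos hu]
    field_simp; ring
  · rw [if_neg hu]
    split_ifs with h1
    · have : u = t := by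
        by_contra hne
        exact hu ⟨lt_of_le_of_ne (by linarith [h1.2]) (Ne.symm hne), by linarith [h1.1]⟩
      subst this
      field_simp; ring
    · simp

lemma Ker_integral {x t : ℝ} (hx : x ∈ Ioo (-1 : ℝ) 1) (ht : t ∈ Icc (-1 : ℝ) 1) (hne : t ≠ x)
    (g : ℝ → ℝ) :
    ∫ u in (-1 : ℝ)..1, Ker x t u * g u = (∫ u in x..t, (t - u) * g u) / (t - x) := by
  rw [intervalIntegral.integral_of_le (by norm_num)]
  rcases lt_or_gt_of_ne hne with h | h
  · have : ∀ u, Ker x t u * g u = (Ioo t x).indicator (fun u => (t - u) * g u / (x - t)) u := by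
      intro u
      rw [Ker_lt h, indicator_apply, indicator_apply]
      split_ifs <;> ring
    simp_rw [this]
    rw [setIntegral_indicator measurableSet_Ioo]
    have : Ioc (-1 : ℝ) 1 ∩ Ioo t x = Ioo t x := by
      rw [inter_eq_right]; intro u hu; exact ⟨ht.1.trans_lt hu.1, (hu.2.trans hx.2).le⟩
    rw [this, ← integral_Ioc_eq_integral_Ioo, ← intervalIntegral.integral_of_le h.le,
      intervalIntegral.integral_symm x t, intervalIntegral.integral_div]
    have : x - t ≠ 0 := by linarith
    have : t - x ≠ 0 := by linarith
    rw [← neg_sub x t, div_neg]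
  · have : ∀ u, Ker x t u * g u = (Ioc x t).indicator (fun u => (t - u) * g u / (t - x)) u := by
      intro u
      rw [Ker_gt h, indicator_apply, indicator_apply]
      split_ifs <;> ring
    simp_rw [this]
    rw [setIntegral_indicator measurableSet_Ioc]
    have : Ioc (-1 : ℝ) 1 ∩ Ioc x t = Ioc x t := by
      rw [inter_eq_right]; intro u hu; exact ⟨hx.1.trans hu.1, hu.2.trans ht.2⟩
    rw [this, ← intervalIntegral.integral_of_le h.le, intervalIntegral.integral_div]

lemma taylor_int {f f' g : ℝ → ℝ} {x t : ℝ}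
    (hd : ∀ x ∈ Set.Icc (-1 : ℝ) 1, HasDerivWithinAt f (f' x) (Set.Icc (-1 : ℝ) 1) x)
    (hg : IntervalIntegrable g volume (-1) 1)
    (hf' : ∀ x ∈ Set.Icc (-1 : ℝ) 1, f' x = f' (-1) + ∫ t in (-1 : ℝ)..x, g t)
    (hx : x ∈ Icc (-1 : ℝ) 1) (ht : t ∈ Icc (-1 : ℝ) 1) :
    f t - f x = f' x * (t - x) + ∫ u in x..t, (t - u) * g u := by
  have hsub : uIcc x t ⊆ Icc (-1 : ℝ) 1 := by
    rw [← uIcc_of_le (by norm_num : (-1 : ℝ) ≤ 1)] at *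
    exact uIcc_subset_uIcc hx ht
  have hsub' : uIcc x t ⊆ uIcc (-1 : ℝ) 1 := by
    rwa [uIcc_of_le (by norm_num : (-1 : ℝ) ≤ 1)]
  have hAC : AbsolutelyContinuousOnInterval (fun s => ∫ v in (-1 : ℝ)..s, g v) (-1) 1 :=
    hg.absolutelyContinuousOnInterval_intervalIntegral (by simp)
  have hAC' := hAC.mono hsub'
  have hcF := hAC'.continuousOn
  have hcf' : ContinuousOn f' (uIcc x t) := by
    refine ((continuousOn_const (c := f' (-1))).add hcF).congr ?_
    intro s hs; exact hf' s (hsub hs)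
  have h1 : ∫ s in x..t, f' s = f t - f x := by
    apply intervalIntegral.integral_eq_sub_of_hasDeriv_right
    · intro s hs; exact (hd s (hsub hs)).continuousWithinAt.mono hsub
    · intro s hs
      have hs' : s ∈ Ioo (-1 : ℝ) 1 :=
        ⟨(le_min hx.1 ht.1).trans_lt hs.1, hs.2.trans_le (max_le hx.2 ht.2)⟩
      exact ((hd s (Ioo_subset_Icc_self hs')).hasDerivAt (Icc_mem_nhds hs'.1 hs'.2)).hasDerivWithinAt
    · exact hcf'.intervalIntegrable
  have h2 : ∫ s in x..t, f' s = ∫ s in x..t, (f' (-1) + ∫ v in (-1 : ℝ)..s, g v) :=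
    intervalIntegral.integral_congr fun s hs => hf' s (hsub hs)
  rw [intervalIntegral.integral_add (by simp) hcF.intervalIntegrable] at h2
  have hl : AbsolutelyContinuousOnInterval (fun s : ℝ => s - t) x t :=
    ContDiffOn.absolutelyContinuousOnInterval (by fun_prop)
  have h3 := hAC'.integral_mul_deriv_eq_deriv_mul hl
  have dl : deriv (fun s : ℝ => s - t) = fun _ => 1 := by ext s; simp
  rw [dl] at h3
  have h4 : ∫ s in x..t, deriv (fun s => ∫ v in (-1 : ℝ)..s, g v) s * (s - t)
      = - ∫ u in x..t, (t - u) * g u := by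
    rw [← intervalIntegral.integral_neg]
    apply intervalIntegral.integral_congr_ae
    filter_upwards [hg.ae_hasDerivAt_integral] with s hs hsx
    rw [(hs (hsub' (uIoc_subset_uIcc hsx)) (-1) (by simp)).deriv]
    ring
  rw [h4] at h3
  simp only [mul_one, sub_self, mul_zero] at h3
  rw [← h1, h2, h3, hf' x hx]
  simp; ring

lemma cot_lim (y : ℝ) (hy : ∀ k : ℤ, y ≠ k) :
    Tendsto (fun n : ℕ => 1 / y + ∑ j ∈ Finset.range n, (1 / (y - (j + 1)) + 1 / (y + (j + 1)))) atTop
      (nhds (Real.pi * Real.cot (Real.pi * y))) := by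
  have hc : (y : ℂ) ∈ Complex.integerComplement := by
    rintro ⟨k, hk⟩
    exact hy k (by exact_mod_cast hk.symm)
  have h := (tendsto_logDeriv_euler_cot_sub hc).const_add (1 / (y : ℂ))
  have h2 := (Complex.continuous_re.tendsto _).comp h
  have e : (1 / (y : ℂ) + (Real.pi * Complex.cot (Real.pi * y) - 1 / y)).re
      = Real.pi * Real.cot (Real.pi * y) := by
    rw [add_sub_cancel]
    rw [← Complex.ofReal_mul, ← Complex.ofReal_cot, ← Complex.ofReal_mul, Complex.ofReal_re]
  rw [e] at h2
  refine h2.congr fun n => ?_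
  rw [Function.comp_apply, ← Complex.ofReal_re (1 / y + _)]
  congr 1
  push_cast
  rfl

lemma s_even (y : ℝ) (M : ℕ) :
    1 / y + ∑ i ∈ Finset.range (2 * M), (-1 : ℝ) ^ (i + 1) * (1 / (y - (i + 1)) + 1 / (y + (i + 1)))
     = (1 / (y / 2) + ∑ j ∈ Finset.range M, (1 / (y / 2 - (j + 1)) + 1 / (y / 2 + (j + 1))))
      - (1 / y + ∑ j ∈ Finset.range (2 * M), (1 / (y - (j + 1)) + 1 / (y + (j + 1)))) := by
  induction M with
  | zero => simp; ring
  | succ M ih =>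
    have : 2 * (M + 1) = 2 * M + 1 + 1 := by ring
    rw [this]
    simp only [Finset.sum_range_succ]
    have p1 : (-1 : ℝ) ^ (2 * M + 1) = -1 := Odd.neg_one_pow ⟨M, rfl⟩
    have p2 : (-1 : ℝ) ^ (2 * M + 1 + 1) = 1 := Even.neg_one_pow ⟨M + 1, by ring⟩
    rw [p1, p2]
    have q1 : 1 / (y / 2 - ((M : ℝ) + 1)) = 2 * (1 / (y - (((2 * M + 1 : ℕ) : ℝ) + 1))) := by
      have : y / 2 - ((M : ℝ) + 1) = (y - (((2 * M + 1 : ℕ) : ℝ) + 1)) / 2 := by push_cast; ring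
      rw [this, one_div_div]; ring
    have q2 : 1 / (y / 2 + ((M : ℝ) + 1)) = 2 * (1 / (y + (((2 * M + 1 : ℕ) : ℝ) + 1))) := by
      have : y / 2 + ((M : ℝ) + 1) = (y + (((2 * M + 1 : ℕ) : ℝ) + 1)) / 2 := by push_cast; ring
      rw [this, one_div_div]; ring
    rw [q1, q2]
    linarith

lemma s_lim (y : ℝ) (hy : ∀ k : ℤ, y ≠ k) :
    Tendsto (fun M : ℕ => 1 / y + ∑ i ∈ Finset.range (2 * M),
      (-1 : ℝ) ^ (i + 1) * (1 / (y - (i + 1)) + 1 / (y + (i + 1)))) atTop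
      (nhds (Real.pi / Real.sin (Real.pi * y))) := by
  have hy2 : ∀ k : ℤ, y / 2 ≠ k := by
    intro k hk; apply hy (2 * k); push_cast; linarith
  have h1 := cot_lim (y / 2) hy2
  have h2 := (cot_lim y hy).comp (tendsto_id.const_mul_atTop' (show 0 < 2 by norm_num))
  have h3 := h1.sub h2
  have sne : ∀ z : ℝ, (∀ k : ℤ, z ≠ k) → Real.sin (Real.pi * z) ≠ 0 := by
    intro z hz h0
    obtain ⟨k, hk⟩ := Real.sin_eq_zero_iff.1 h0
    apply hz k
    have := Real.pi_ne_zero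
    rw [mul_comm] at hk
    exact (mul_left_cancel₀ this hk).symm
  have e : Real.pi * Real.cot (Real.pi * (y / 2)) - Real.pi * Real.cot (Real.pi * y)
      = Real.pi / Real.sin (Real.pi * y) := by
    have s1 := sne _ hy
    have s2 := sne _ hy2
    have d : Real.pi * y = 2 * (Real.pi * (y / 2)) := by ring
    rw [Real.cot_eq_cos_div_sin, Real.cot_eq_cos_div_sin]
    rw [d] at s1 ⊢
    rw [Real.sin_two_mul] at s1 ⊢
    rw [Real.cos_two_mul]
    have c2 : Real.cos (Real.pi * (y / 2)) ≠ 0 := fun h => s1 (by rw [h]; ring)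
    field_simp
    ring
  rw [e] at h3
  refine h3.congr fun M => ?_
  rw [s_even]; rfl

lemma den_bound (n : ℕ) (y : ℝ) (hy : ∀ k : ℤ, y ≠ k) (h0 : 0 < y) (hn : y < n) :
    |∑ k ∈ Finset.range (n + 1), (-1 : ℝ) ^ k / (y - k) - Real.pi / Real.sin (Real.pi * y)|
      ≤ 1 / (y + 1) + 1 / (n + 1 - y) := by
  have hl := ((s_lim y hy).const_sub
    (∑ k ∈ Finset.range (n + 1), (-1 : ℝ) ^ k / (y - k))).abs
  refine le_of_tendsto hl ?_
  filter_upwards [eventually_ge_atTop n] with M hM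
  obtain ⟨r, hr⟩ : ∃ r, 2 * M = n + r := ⟨2 * M - n, by omega⟩
  have e : 1 / y + ∑ i ∈ Finset.range (2 * M),
      (-1 : ℝ) ^ (i + 1) * (1 / (y - (i + 1)) + 1 / (y + (i + 1)))
      = ∑ k ∈ Finset.range (n + 1), (-1 : ℝ) ^ k / (y - k)
        + (-1) ^ n * ∑ i ∈ Finset.range r, (-1 : ℝ) ^ i * (1 / (n + 1 - y + i))
        - ∑ i ∈ Finset.range (2 * M), (-1 : ℝ) ^ i * (1 / (y + 1 + i)) := by
    have e1 : 1 / y + ∑ i ∈ Finset.range (2 * M), (-1 : ℝ) ^ (i + 1) * (1 / (y - (i + 1)))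
        = ∑ k ∈ Finset.range (n + 1 + r), (-1 : ℝ) ^ k / (y - k) := by
      rw [show n + 1 + r = 2 * M + 1 by omega, Finset.sum_range_succ', add_comm]
      congr 1
      · refine Finset.sum_congr rfl fun i _ => ?_
        push_cast; ring
      · simp
    rw [Finset.sum_range_add] at e1
    have e2 : ∑ i ∈ Finset.range r, (-1 : ℝ) ^ (n + 1 + i) / (y - ((n + 1 + i : ℕ) : ℝ))
        = (-1) ^ n * ∑ i ∈ Finset.range r, (-1 : ℝ) ^ i * (1 / (n + 1 - y + i)) := by
      rw [Finset.mul_sum]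
      refine Finset.sum_congr rfl fun i _ => ?_
      have : y - ((n + 1 + i : ℕ) : ℝ) = -(n + 1 - y + i) := by push_cast; ring
      rw [this, div_neg]; ring
    rw [e2] at e1
    rw [← e1]
    simp_rw [mul_add, Finset.sum_add_distrib]
    have e3 : ∑ i ∈ Finset.range (2 * M), (-1 : ℝ) ^ (i + 1) * (1 / (y + (i + 1)))
      = - ∑ i ∈ Finset.range (2 * M), (-1 : ℝ) ^ i * (1 / (y + 1 + i)) := by
      rw [← Finset.sum_neg_distrib]
      refine Finset.sum_congr rfl fun i _ => ?_
      rw [show y + ((i : ℝ) + 1) = y + 1 + i by ring]; ring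
    rw [e3]; ring
  have anti : ∀ a : ℝ, 0 < a → ∀ r : ℕ, |∑ i ∈ Finset.range r, (-1 : ℝ) ^ i * (1 / (a + i))| ≤ 1 / a := by
    intro a ha r
    have := alt_aux r (fun i => 1 / (a + i)) (fun i j hij => by
      have : (i : ℝ) ≤ j := by exact_mod_cast hij
      exact one_div_le_one_div_of_le (by positivity) (by linarith)) (fun i => by positivity)
    simp only [Nat.cast_zero, add_zero] at this
    rw [abs_le]; constructor <;> linarith [this.1, this.2, one_div_pos.2 ha]
  have a1 := anti (n + 1 - y) (by linarith) r
  have a2 := anti (y + 1) (by linarith) (2 * M)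
  rw [e]
  have : ∀ A B C : ℝ, |A - (A + (-1) ^ n * B - C)| ≤ |C| + |B| := by
    intro A B C
    rw [show A - (A + (-1) ^ n * B - C) = C - (-1) ^ n * B by ring]
    refine (abs_sub _ _).trans ?_
    rw [abs_mul, abs_pow]; simp
  exact (this _ _ _).trans (by linarith)

lemma odd_dense (x : ℝ) (hx : Irrational x) (s : ℝ) (hs : |s| ≤ 1) :
    ∃ m : ℕ → ℕ, StrictMono m ∧ Tendsto (fun j => Real.sin (Real.pi * ((2 * m j + 1 : ℕ) * (x + 1) / 2)))
      atTop (nhds s) := by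
  have : Fact ((0 : ℝ) < 2) := ⟨by norm_num⟩
  have hir : Irrational ((x + 1) / 2) := by
    have := (hx.add_natCast 1).div_natCast (m := 2) (by norm_num)
    simpa using this
  have hd := AddCircle.denseRange_zsmul_coe_iff.2 hir
  set F : ℝ → ℝ := fun t => Real.sin (Real.pi * (t + (x + 1) / 2)) with hF
  have hper : Function.Periodic F 2 := by
    intro t
    simp only [hF]
    rw [show Real.pi * (t + 2 + (x + 1) / 2) = Real.pi * (t + (x + 1) / 2) + 2 * Real.pi by ring,
      Real.sin_add_two_pi]
  have hcont : Continuous (hper.lift : AddCircle (2 : ℝ) → ℝ) := by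
    apply continuous_coinduced_dom.2
    change Continuous F
    fun_prop
  set p : ℝ := Real.arcsin s / Real.pi - (x + 1) / 2 with hp
  have hcl : MapClusterPt (p : AddCircle (2 : ℝ)) atTop
      (fun n : ℕ => n • ((x + 1 : ℝ) : AddCircle (2 : ℝ))) :=
    ((mapClusterPt_atTop_nsmul_tfae _ _).out 0 3).2 (hd.closure_range ▸ mem_univ _)
  have h2 := hcl.continuousAt_comp hcont.continuousAt
  obtain ⟨m, hm, ht⟩ := MapClusterPt.tendsto_subseq h2
  refine ⟨m, hm, ?_⟩
  have e : hper.lift (p : AddCircle (2 : ℝ)) = s := by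
    rw [Function.Periodic.lift_coe]
    simp only [hF, hp]
    rw [sub_add_cancel, mul_div_cancel₀ _ Real.pi_ne_zero]
    rw [abs_le] at hs
    exact Real.sin_arcsin hs.1 hs.2
  rw [e] at ht
  refine ht.congr fun j => ?_
  simp only [Function.comp_apply]
  rw [← AddCircle.coe_nsmul, Function.Periodic.lift_coe]
  simp only [hF]
  congr 2
  push_cast
  simp; ring

lemma alt_ident (n : ℕ) (a : ℕ → ℝ) :
    2 * ∑ k ∈ Finset.range (n + 1), (-1 : ℝ) ^ k * a k
      = a 0 + (-1) ^ n * a n - ∑ k ∈ Finset.range n, (-1 : ℝ) ^ k * (a (k + 1) - a k) := by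
  induction n with
  | zero => simp; ring
  | succ n ih =>
    rw [Finset.sum_range_succ, mul_add, ih, Finset.sum_range_succ _ n]
    ring

lemma irr_node {x : ℝ} (hirr : Irrational x) (n k : ℕ) : node n k ≠ x := by
  intro h
  apply hirr
  refine ⟨2 * k / n - 1, ?_⟩
  rw [← h, node]; push_cast; rfl

lemma num_tendsto (f : ℝ → ℝ) (hf : AC1 f) (x : ℝ) (hx : x ∈ Set.Ioo (-1 : ℝ) 1)
    (hirr : Irrational x) :
    Tendsto (fun m : ℕ => Nnum f (2 * m + 1) x - f x * Dden (2 * m + 1) x) atTop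
      (nhds (Ofun f x)) := by
  obtain ⟨f', hd, g, hg, hf'⟩ := hf
  set φ : ℝ → ℝ := fun t => (f t - f x) / (t - x) with hφ
  have hT : Tendsto (fun n : ℕ => Talt n φ) atTop (nhds 0) := by
    apply Talt_tendsto x g φ (f' x) hg
    intro n k hn hk
    have hne : (2 * (k : ℝ) / n - 1) ≠ x := irr_node hirr n k
    have hn' : (0 : ℝ) < n := by exact_mod_cast hn
    have hk' : (k : ℝ) ≤ n := by exact_mod_cast hk
    have hmem : (2 * (k : ℝ) / n - 1) ∈ Icc (-1 : ℝ) 1 := by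
      have h1 : 0 ≤ 2 * (k : ℝ) / n := by positivity
      have h2 : 2 * (k : ℝ) / n ≤ 2 := by rw [div_le_iff₀ hn']; linarith
      constructor <;> linarith
    rw [Ker_integral hx hmem hne g]
    simp only [hφ]
    rw [taylor_int hd hg hf' (Ioo_subset_Icc_self hx) hmem, add_div, mul_div_cancel_right₀]
    exact sub_ne_zero.2 hne
  have hodd : Tendsto (fun m : ℕ => 2 * m + 1) atTop atTop :=
    tendsto_atTop_mono (fun m => by simp only [id]; omega) tendsto_id
  have h1 := ((hT.comp hodd).const_add (-(φ (-1) - φ 1))).mul_const (1 / 2 : ℝ)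
  have e : (-(φ (-1) - φ 1) + 0) * (1 / 2 : ℝ) = Ofun f x := by
    simp only [hφ, Ofun]
    have a1 : x - 1 ≠ 0 := by linarith [hx.2]
    have a2 : x + 1 ≠ 0 := by linarith [hx.1]
    have a3 : 1 - x ≠ 0 := by linarith [hx.2]
    have a4 : -1 - x ≠ 0 := by linarith [hx.1]
    rw [show -1 - x = -(x + 1) by ring, show 1 - x = -(x - 1) by ring]
    field_simp
    ring
  rw [e] at h1
  refine h1.congr fun m => ?_
  have hid := alt_ident (2 * m + 1) (fun k => φ (node (2 * m + 1) k))
  have n0 : node (2 * m + 1) 0 = -1 := by simp [node]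
  have n1 : node (2 * m + 1) (2 * m + 1) = 1 := by
    rw [node, mul_div_assoc, div_self (by positivity)]; norm_num
  have p1 : (-1 : ℝ) ^ (2 * m + 1) = -1 := Odd.neg_one_pow ⟨m, rfl⟩
  have hTe : ∑ k ∈ Finset.range (2 * m + 1), (-1 : ℝ) ^ k *
      (φ (node (2 * m + 1) (k + 1)) - φ (node (2 * m + 1) k)) = Talt (2 * m + 1) φ := rfl
  simp only [n0, n1, p1, hTe] at hid
  have hN : Nnum f (2 * m + 1) x - f x * Dden (2 * m + 1) x
      = - ∑ k ∈ Finset.range (2 * m + 1 + 1), (-1 : ℝ) ^ k * φ (node (2 * m + 1) k) := by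
    rw [Nnum, Dden, Finset.mul_sum, ← Finset.sum_sub_distrib, ← Finset.sum_neg_distrib]
    refine Finset.sum_congr rfl fun k _ => ?_
    simp only [hφ]
    rw [← neg_sub x (node (2 * m + 1) k), div_neg]
    ring
  rw [hN]
  simp only [Function.comp_apply]
  linarith

lemma den_tendsto (x : ℝ) (hx : x ∈ Set.Ioo (-1 : ℝ) 1) (hirr : Irrational x) :
    Tendsto (fun m : ℕ => 2 * Dden (2 * m + 1) x / (2 * m + 1 : ℕ)
      - Real.pi / Real.sin (Real.pi * ((2 * m + 1 : ℕ) * (x + 1) / 2))) atTop (nhds 0) := by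
  have hodd : Tendsto (fun m : ℕ => 2 * m + 1) atTop atTop :=
    tendsto_atTop_mono (fun m => by simp only [id]; omega) tendsto_id
  have hb : Tendsto (fun n : ℕ => (2 / (x + 1) + 2 / (1 - x)) / (n : ℝ)) atTop (nhds 0) :=
    tendsto_const_div_atTop_nhds_zero_nat _
  refine squeeze_zero_norm (fun m => ?_) (hb.comp hodd)
  simp only [Function.comp_apply]
  generalize hn : 2 * m + 1 = n
  have hn0 : (0 : ℝ) < n := by rw [← hn]; positivity
  have x1 : 0 < x + 1 := by linarith [hx.1]
  have x2 : 0 < 1 - x := by linarith [hx.2]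
  set y : ℝ := n * (x + 1) / 2 with hy
  have hyirr : Irrational y := by
    have := ((hirr.add_natCast 1).natCast_mul (m := n) (by omega)).div_natCast (m := 2) (by norm_num)
    simpa [hy] using this
  have h := den_bound n y (fun k => hyirr.ne_int k) (by positivity) (by rw [hy]; nlinarith)
  have e : 2 * Dden n x / n = ∑ k ∈ Finset.range (n + 1), (-1 : ℝ) ^ k / (y - k) := by
    rw [Dden, Finset.mul_sum, Finset.sum_div]
    refine Finset.sum_congr rfl fun k _ => ?_
    have : x - node n k = (y - k) * (2 / n) := by
      rw [node, hy]; field_simp; ring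
    rw [this]
    have : y - k ≠ 0 := sub_ne_zero.2 (hyirr.ne_nat k)
    field_simp
  rw [e, Real.norm_eq_abs]
  refine h.trans ?_
  have b1 : 1 / (y + 1) ≤ 2 / (x + 1) / n := by
    rw [div_div, div_le_div_iff₀ (by positivity) (by positivity), hy]; nlinarith
  have b2 : 1 / (n + 1 - y) ≤ 2 / (1 - x) / n := by
    have : n + 1 - y = n * (1 - x) / 2 + 1 := by rw [hy]; ring
    rw [this, div_div, div_le_div_iff₀ (by positivity) (by positivity)]; nlinarith
  rw [add_div]; linarith

lemma main_lim (f : ℝ → ℝ) (hf : AC1 f) (x : ℝ) (hx : x ∈ Set.Ioo (-1 : ℝ) 1)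
    (hirr : Irrational x) (s : ℝ) (m : ℕ → ℕ) (hm : StrictMono m)
    (hs : Tendsto (fun j => Real.sin (Real.pi * ((2 * m j + 1 : ℕ) * (x + 1) / 2))) atTop (nhds s)) :
    Tendsto (fun j : ℕ => ((2 * m j + 1 : ℕ) : ℝ) * (berrut f (2 * m j + 1) x - f x)) atTop
      (nhds (Ofun f x * (2 * s / Real.pi))) := by
  have hN := (num_tendsto f hf x hx hirr).comp hm.tendsto_atTop
  have hD := (den_tendsto x hx hirr).comp hm.tendsto_atTop
  have h1 := (hs.const_mul 2).div ((hD.mul hs).const_add Real.pi) (by simpa using Real.pi_ne_zero)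
  have h2 := hN.mul h1
  rw [zero_mul, add_zero] at h2
  refine (h2.congr' ?_)
  have hev := (((hD.mul hs).const_add Real.pi)).eventually_ne
    (show Real.pi + 0 * s ≠ 0 by simpa using Real.pi_ne_zero)
  filter_upwards [hev] with j hj
  simp only [Function.comp_apply, Pi.div_apply] at hj ⊢
  generalize hn : 2 * m j + 1 = n at hj ⊢
  have hnpos : (n : ℝ) ≠ 0 := by rw [← hn]; positivity
  have hyirr : Irrational ((n : ℝ) * (x + 1) / 2) := by
    have := ((hirr.add_natCast 1).natCast_mul (m := n) (by omega)).div_natCast (m := 2) (by norm_num)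
    simpa using this
  have hsin : Real.sin (Real.pi * (n * (x + 1) / 2)) ≠ 0 := by
    intro h0
    obtain ⟨k, hk⟩ := Real.sin_eq_zero_iff.1 h0
    rw [mul_comm] at hk
    exact hyirr.ne_int k (mul_left_cancel₀ Real.pi_ne_zero hk).symm
  have hnode : ¬ isNode n x := by
    rintro ⟨k, _, hk⟩
    exact irr_node hirr n k hk.symm
  rw [berrut, if_neg hnode]
  set S := Real.sin (Real.pi * (n * (x + 1) / 2))
  have e : Real.pi + (2 * Dden n x / n - Real.pi / S) * S = 2 * Dden n x * S / n := by
    field_simp; ring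
  rw [e] at hj ⊢
  have hDne : Dden n x ≠ 0 := by
    intro h; apply hj; rw [h]; simp
  field_simp

/-- for `f ∈ AC¹` and irrational `x ∈ (-1,1)`, every real `L` with
`|L| ≤ 2|O(f,x)|/π` is attained as a limit of `n_j (B_{n_j}(f,x) - f(x))` along some
odd sequence. -/
theorem statement4 (f : ℝ → ℝ) (hf : AC1 f) (x : ℝ) (hx : x ∈ Set.Ioo (-1 : ℝ) 1)
    (hirr : Irrational x) (L : ℝ) (hL : |L| ≤ 2 * |Ofun f x| / Real.pi) :
    ∃ n : ℕ → ℕ, StrictMono n ∧ (∀ j, Odd (n j) ∧ 0 < n j) ∧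
      Filter.Tendsto (fun j : ℕ => (n j : ℝ) * (berrut f (n j) x - f x))
        Filter.atTop (nhds L) := by
  obtain ⟨s, hs, hsL⟩ : ∃ s : ℝ, |s| ≤ 1 ∧ Ofun f x * (2 * s / Real.pi) = L := by
    by_cases hO : Ofun f x = 0
    · refine ⟨0, by simp, ?_⟩
      rw [hO] at hL
      have : |L| ≤ 0 := by simpa using hL
      have := abs_nonpos_iff.1 this
      simp [this]
    · have hpi := Real.pi_pos
      refine ⟨L * Real.pi / (2 * Ofun f x), ?_, by field_simp⟩
      have hO' : 0 < |Ofun f x| := abs_pos.2 hO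
      rw [abs_div, abs_mul, abs_mul, abs_of_pos hpi, abs_two, div_le_one (by positivity)]
      rwa [le_div_iff₀ hpi] at hL
  obtain ⟨m, hm, ht⟩ := odd_dense x hirr s hs
  refine ⟨fun j => 2 * m j + 1, fun a b h => ?_, fun j => ⟨⟨m j, rfl⟩, Nat.succ_pos _⟩, ?_⟩
  · have := hm h
    simp only; omega
  · have := main_lim f hf x hx hirr s m hm ht
    rwa [hsL] at this
end

section
/- Let f ∈ AC¹, let x ∈ (−1,1) be irrational, and let (n_j) be a strictly increasing sequence of even positive integers such that n_j (B_{n_j}(f,x) − f(x)) converges in the two-point compactification ℝ ∪ {±∞} to a limit L. Then L is finite and |L| ≤ 2|E(f,x)|/π. -/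
open Filter Set MeasureTheory

lemma aux_alt (m : ℕ) : ∀ a : ℕ → ℝ, (∀ i, 0 ≤ a i) → (∀ i, a (i+1) ≤ a i) →
    0 ≤ ∑ i ∈ Finset.range m, (-1:ℝ)^i * a i ∧ ∑ i ∈ Finset.range m, (-1:ℝ)^i * a i ≤ a 0 := by
  induction m with
  | zero => intro a h0 _; simpa using h0 0
  | succ m ih =>
    intro a h0 h1
    rw [Finset.sum_range_succ']
    have := ih (fun i => a (i+1)) (fun i => h0 _) (fun i => h1 _)
    have e : ∑ k ∈ Finset.range m, (-1:ℝ) ^ (k + 1) * a (k + 1)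
        = - ∑ k ∈ Finset.range m, (-1:ℝ) ^ k * a (k + 1) := by
      rw [← Finset.sum_neg_distrib]
      refine Finset.sum_congr rfl fun k _ => ?_
      ring
    rw [e]
    have h2 := h1 0
    simp only [zero_add] at this h2
    simp only [pow_zero, one_mul]
    constructor <;> linarith [this.1, this.2]

lemma aux_tail (a : ℕ → ℝ) (h0 : ∀ i, 0 ≤ a i) (h1 : ∀ i, a (i+1) ≤ a i) (M p : ℕ) (h : M ≤ p) :
    ∑ i ∈ Finset.range M, (-1:ℝ)^i * a i - a M ≤ ∑ i ∈ Finset.range p, (-1:ℝ)^i * a i := by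
  obtain ⟨q, rfl⟩ := Nat.exists_eq_add_of_le h
  rw [Finset.sum_range_add]
  have := aux_alt q (fun i => a (M+i)) (fun i => h0 _) (fun i => h1 _)
  have e : ∑ k ∈ Finset.range q, (-1:ℝ) ^ (M + k) * a (M + k)
      = (-1)^M * ∑ k ∈ Finset.range q, (-1:ℝ) ^ k * a (M + k) := by
    rw [Finset.mul_sum]
    refine Finset.sum_congr rfl fun k _ => ?_
    ring
  rw [e]
  simp only [add_zero] at this
  rcases neg_one_pow_eq_or ℝ M with h | h <;> rw [h] <;> nlinarith [this.1, this.2, h0 M]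

lemma aux_lower (r : ℝ) (h0 : 0 < r) (h1 : r < 1) (p q M : ℕ) (hM : 0 < M) (hp : M ≤ p) (hq : M ≤ q) :
    4 * ∑ i ∈ Finset.range M, (-1:ℝ)^i / (2 * i + 1) - 2 / M ≤
    ∑ i ∈ Finset.range p, (-1:ℝ)^i * (1 / (r + i)) + ∑ i ∈ Finset.range q, (-1:ℝ)^i * (1 / (i + 1 - r)) := by
  have hi : ∀ i : ℕ, (0:ℝ) ≤ i := fun i => Nat.cast_nonneg i
  have A := aux_tail (fun i => 1 / (r + i)) (fun i => by have := hi i; positivity)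
    (fun i => by
      have := hi i
      apply one_div_le_one_div_of_le
      · positivity
      · push_cast; linarith) M p hp
  have B := aux_tail (fun i => 1 / ((i:ℝ) + 1 - r)) (fun i => by
      have := hi i
      apply one_div_nonneg.2; linarith)
    (fun i => by
      have := hi i
      apply one_div_le_one_div_of_le
      · linarith
      · push_cast; linarith) M q hq
  have hM' : (0:ℝ) < M := by exact_mod_cast hM
  have A1 : 1 / (r + M) ≤ 1 / (M:ℝ) := one_div_le_one_div_of_le hM' (by linarith)
  have B1 : 1 / ((M:ℝ) + 1 - r) ≤ 1 / (M:ℝ) := one_div_le_one_div_of_le hM' (by linarith)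
  set y : ℝ := (2*r-1)^2 with hy
  have hy0 : 0 ≤ y := sq_nonneg _
  have hy1 : y < 1 := by nlinarith
  have hd : ∀ i : ℕ, 0 < (2*(i:ℝ)+1)^2 - y := fun i => by nlinarith [hi i]
  have C := (aux_alt M (fun i => y / ((2*(i:ℝ)+1) * ((2*(i:ℝ)+1)^2 - y)))
    (fun i => by have := hi i; have := hd i; positivity)
    (fun i => by
      have h2 := hi i; have h3 := hd i
      apply div_le_div_of_nonneg_left hy0 (by positivity)
      push_cast
      apply mul_le_mul <;> nlinarith)).1
  have key : ∑ i ∈ Finset.range M, (-1:ℝ)^i * (1 / (r + i)) + ∑ i ∈ Finset.range M, (-1:ℝ)^i * (1 / (i + 1 - r))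
      = 4 * ∑ i ∈ Finset.range M, (-1:ℝ)^i / (2 * i + 1) +
        4 * ∑ i ∈ Finset.range M, (-1:ℝ)^i * (y / ((2*(i:ℝ)+1) * ((2*(i:ℝ)+1)^2 - y))) := by
    rw [Finset.mul_sum, Finset.mul_sum, ← Finset.sum_add_distrib, ← Finset.sum_add_distrib]
    refine Finset.sum_congr rfl fun i _ => ?_
    have h2 := hi i
    have h3 : r + i ≠ 0 := by positivity
    have h4 : (i:ℝ) + 1 - r ≠ 0 := by linarith
    have h5 : 2*(i:ℝ)+1 ≠ 0 := by positivity
    have h6 : (2*(i:ℝ)+1)^2 - y = 4 * ((r+i) * (i+1-r)) := by rw [hy]; ring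
    rw [h6, hy]
    field_simp
    ring
  have e2 : (2:ℝ)/M = 1/M + 1/M := by ring
  rw [e2]
  linarith

lemma aux_S (u : ℝ) (n k0 : ℕ) (hk : k0 < n) (h0 : (k0:ℝ) < u) (h1 : u < k0 + 1) (M : ℕ) (hM : 0 < M)
    (hp : M ≤ k0 + 1) (hq : M ≤ n - k0) :
    4 * ∑ i ∈ Finset.range M, (-1:ℝ)^i / (2 * i + 1) - 2 / M ≤
    |∑ k ∈ Finset.range (n+1), (-1:ℝ)^k / (u - k)| := by
  have h := aux_lower (u - k0) (by linarith) (by linarith) (k0+1) (n-k0) M hM hp hq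
  have e : n + 1 = (k0 + 1) + (n - k0) := by omega
  have key : ∑ k ∈ Finset.range (n+1), (-1:ℝ)^k / (u - k) = (-1)^k0 * (∑ i ∈ Finset.range (k0+1), (-1:ℝ)^i * (1 / (u - k0 + i)) + ∑ i ∈ Finset.range (n-k0), (-1:ℝ)^i * (1 / (i + 1 - (u-k0)))) := by
    rw [e, Finset.sum_range_add, ← Finset.sum_range_reflect, mul_add, Finset.mul_sum, Finset.mul_sum]
    congr 1
    · refine Finset.sum_congr rfl fun i hi => ?_
      have hi' : i ≤ k0 := by simpa [Nat.lt_succ_iff] using hi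
      obtain ⟨c, rfl⟩ := Nat.exists_eq_add_of_le hi'
      have : i + c + 1 - 1 - i = c := by omega
      rw [this]
      have hs : (-1:ℝ)^(i+c) * (-1)^i = (-1)^c := by
        rw [pow_add, mul_right_comm, ← pow_add, Even.neg_one_pow ⟨i, rfl⟩, one_mul]
      rw [← mul_assoc, hs]
      push_cast
      rw [mul_one_div]; congr 1; ring
    · refine Finset.sum_congr rfl fun i hi => ?_
      push_cast
      have h2 : u - (k0 + 1 + i) = -((i:ℝ)+1-(u-k0)) := by ring
      rw [h2, div_neg, pow_add, pow_add]
      ring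
  rw [key, abs_mul, abs_pow, abs_neg, abs_one, one_pow, one_mul]
  exact h.trans (le_abs_self _)

lemma aux_transl (Φ : ℝ → ℝ) (h : Integrable Φ) :
    Tendsto (fun d : ℝ => ∫ t, |Φ (t + d) - Φ t|) (nhds 0) (nhds 0) := by
  have hm : MemLp Φ 1 volume := memLp_one_iff_integrable.2 h
  have : Fact ((1:ENNReal) ≠ ⊤) := ⟨by simp⟩
  have hc : Continuous (fun d : ℝ => (DomAddAct.mk d) +ᵥ (hm.toLp Φ)) := by
    have h1 : Continuous (fun d : ℝ => DomAddAct.mk d) := DomAddAct.continuous_mk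
    exact h1.vadd continuous_const
  have h2 : Continuous (fun d : ℝ => ‖((DomAddAct.mk d) +ᵥ (hm.toLp Φ)) - hm.toLp Φ‖) :=
    (hc.sub continuous_const).norm
  have h3 := h2.tendsto 0
  have e : ∀ d : ℝ, ‖((DomAddAct.mk d) +ᵥ (hm.toLp Φ)) - hm.toLp Φ‖ = ∫ t, |Φ (t + d) - Φ t| := by
    intro d
    rw [DomAddAct.mk_vadd_toLp, ← MemLp.toLp_sub, L1.norm_eq_integral_norm]
    apply integral_congr_ae
    filter_upwards [MemLp.coeFn_toLp (((hm.comp_measurePreserving (measurePreserving_vadd d volume))).sub hm)] with t ht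
    refine (congrArg (fun z : ℝ => ‖z‖) ht).trans ?_
    simp [add_comm]
  simp only [e] at h3
  simpa using h3

lemma aux_pair (Φ : ℝ → ℝ) (h : Integrable Φ) (P : ℝ → ℝ) (c : ℝ)
    (hP : ∀ t, P t = c + ∫ u in (-1:ℝ)..t, Φ u) (a e : ℝ) (he : 0 ≤ e) (m : ℕ) :
    |∑ j ∈ Finset.range m, (P (a + (2*j)*e) - 2 * P (a + (2*j+1)*e) + P (a + (2*j+2)*e))|
      ≤ ∫ t, |Φ (t + e) - Φ t| := by
  have hi : ∀ b d, IntervalIntegrable Φ volume b d := fun b d => h.intervalIntegrable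
  have hs : Integrable (fun t => Φ (t + e)) := h.comp_add_right e
  have hd : Integrable (fun t => |Φ (t + e) - Φ t|) := (hs.sub h).abs
  have hPd : ∀ b d, P d - P b = ∫ u in b..d, Φ u := by
    intro b d
    rw [hP, hP, ← intervalIntegral.integral_interval_sub_left (hi (-1) d) (hi (-1) b)]
    ring
  have step : ∀ j : ℕ, |P (a + (2*j)*e) - 2 * P (a + (2*j+1)*e) + P (a + (2*j+2)*e)| ≤
      ∫ t in (a + (2*(j:ℕ))*e)..(a + (2*((j+1:ℕ):ℝ))*e), |Φ (t + e) - Φ t| := by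
    intro j
    have e1 : P (a + (2*j)*e) - 2 * P (a + (2*j+1)*e) + P (a + (2*j+2)*e)
        = ∫ t in (a + (2*j)*e)..(a + (2*j+1)*e), (Φ (t + e) - Φ t) := by
      rw [intervalIntegral.integral_sub hs.intervalIntegrable (hi _ _),
        intervalIntegral.integral_comp_add_right, ← hPd, ← hPd]
      ring_nf
    rw [e1]
    have l1 : a + (2*(j:ℝ))*e ≤ a + (2*j+1)*e := by nlinarith
    refine (intervalIntegral.abs_integral_le_integral_abs l1).trans ?_
    apply intervalIntegral.integral_mono_interval le_rfl l1
    · push_cast; nlinarith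
    · exact Eventually.of_forall fun t => abs_nonneg _
    · exact hd.intervalIntegrable
  refine (Finset.abs_sum_le_sum_abs _ _).trans ((Finset.sum_le_sum fun j _ => step j).trans ?_)
  rw [intervalIntegral.sum_integral_adjacent_intervals (a := fun j : ℕ => a + (2*(j:ℝ))*e)
    (fun k _ => hd.intervalIntegrable)]
  rw [intervalIntegral.integral_of_le (by push_cast; have : 0 ≤ (m:ℝ)*e := by positivity
                                          nlinarith)]
  exact setIntegral_le_integral hd (Eventually.of_forall fun t => abs_nonneg _)

lemma aux_altsum (a : ℕ → ℝ) (m : ℕ) :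
    ∑ k ∈ Finset.range (2*m+1), (-1:ℝ)^k * a k = (a 0 + a (2*m))/2 +
      (1/2) * ∑ j ∈ Finset.range m, (a (2*j) - 2 * a (2*j+1) + a (2*j+2)) := by
  induction m with
  | zero => simp
  | succ m ih =>
    have : 2*(m+1)+1 = 2*m+1+1+1 := by ring
    rw [this, Finset.sum_range_succ, Finset.sum_range_succ, ih, Finset.sum_range_succ]
    have e1 : (-1:ℝ)^(2*m+1) = -1 := by rw [pow_succ, pow_mul]; simp
    have e2 : (-1:ℝ)^(2*m+1+1) = 1 := by rw [pow_succ, e1]; simp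
    rw [e1, e2, show 2*(m+1) = 2*m+2 by ring]
    ring

lemma aux_h (f : ℝ → ℝ) (hf : AC1 f) (x : ℝ) (hx : x ∈ Set.Ioo (-1 : ℝ) 1) :
    ∃ h : ℝ → ℝ, (∀ t ∈ Set.Icc (-1:ℝ) 1, f t - f x = (t - x) * h t) ∧
      Tendsto (fun m : ℕ => ∑ k ∈ Finset.range (2*m+1), (-1:ℝ)^k * h (node (2*m) k)) atTop
        (nhds ((h (-1) + h 1)/2)) := by
  obtain ⟨f', hf', g, hg, hfg⟩ := hf
  set Φ : ℝ → ℝ := Set.indicator (Set.Ioc (-1) 1) g with hΦ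
  have hΦi : Integrable Φ := by
    rw [hΦ, integrable_indicator_iff measurableSet_Ioc]
    exact (intervalIntegrable_iff_integrableOn_Ioc_of_le (by norm_num)).1 hg
  set P : ℝ → ℝ := fun t => f' (-1) + ∫ u in (-1:ℝ)..t, Φ u with hPdef
  have hPc : Continuous P :=
    continuous_const.add (intervalIntegral.continuous_primitive (fun a b => hΦi.intervalIntegrable) _)
  have hPf : ∀ t ∈ Set.Icc (-1:ℝ) 1, f' t = P t := by
    intro t ht
    rw [hfg t ht, hPdef]
    simp only
    congr 1
    rw [intervalIntegral.integral_of_le ht.1, intervalIntegral.integral_of_le ht.1]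
    apply setIntegral_congr_fun measurableSet_Ioc
    intro u hu
    have hu' : u ∈ Set.Ioc (-1:ℝ) 1 := ⟨hu.1, hu.2.trans ht.2⟩
    exact (Set.indicator_of_mem hu' g).symm
  have ftc : ∀ a ∈ Set.Icc (-1:ℝ) 1, ∀ b ∈ Set.Icc (-1:ℝ) 1, a ≤ b → ∫ u in a..b, P u = f b - f a := by
    intro a ha b hb hab
    apply intervalIntegral.integral_eq_sub_of_hasDerivAt_of_le hab
    · intro t ht
      have ht' : t ∈ Set.Icc (-1:ℝ) 1 := ⟨ha.1.trans ht.1, ht.2.trans hb.2⟩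
      exact (hf' t ht').continuousWithinAt.mono (Set.Icc_subset_Icc ha.1 hb.2)
    · intro t ht
      have ht' : t ∈ Set.Icc (-1:ℝ) 1 := ⟨ha.1.trans ht.1.le, ht.2.le.trans hb.2⟩
      rw [← hPf t ht']
      exact (hf' t ht').hasDerivAt (Icc_mem_nhds (ha.1.trans_lt ht.1) (ht.2.trans_le hb.2))
    · exact hPc.intervalIntegrable _ _
  have hx' : x ∈ Set.Icc (-1:ℝ) 1 := ⟨hx.1.le, hx.2.le⟩
  refine ⟨fun t => ∫ s in (0:ℝ)..1, P (x + (t - x) * s), ?_, ?_⟩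
  · intro t ht
    simp only
    rw [intervalIntegral.mul_integral_comp_add_mul]
    simp only [mul_zero, add_zero, mul_one, add_sub_cancel]
    rcases le_total x t with h | h
    · rw [ftc x hx' t ht h]
    · rw [intervalIntegral.integral_symm, ftc t ht x hx' h]; ring
  · set h : ℝ → ℝ := fun t => ∫ s in (0:ℝ)..1, P (x + (t - x) * s) with hh
    have hz : Tendsto (fun m : ℕ => ∑ j ∈ Finset.range m, (h (node (2*m) (2*j)) - 2 * h (node (2*m) (2*j+1)) + h (node (2*m) (2*j+2)))) atTop (nhds 0) := by
      rw [Metric.tendsto_atTop]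
      intro ε hε
      obtain ⟨δ, hδ, hδ'⟩ := Metric.tendsto_nhds_nhds.1 (aux_transl Φ hΦi) (ε/2) (by positivity)
      obtain ⟨N, hN⟩ := exists_nat_gt (1/δ)
      refine ⟨N+1, fun m hm => ?_⟩
      have hm0 : (0:ℝ) < m := by exact_mod_cast (by omega : 0 < m)
      have hmN : (1:ℝ)/δ < m := hN.trans (by exact_mod_cast hm)
      have hmd : 1 / (m:ℝ) < δ := by
        rw [div_lt_iff₀ hδ] at hmN
        rw [div_lt_iff₀ hm0]; linarith
      have hii : ∀ t, IntervalIntegrable (fun s => P (x + (t - x) * s)) volume 0 1 := fun t =>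
        (hPc.comp (by fun_prop)).intervalIntegrable _ _
      have e1 : ∑ j ∈ Finset.range m, (h (node (2*m) (2*j)) - 2 * h (node (2*m) (2*j+1)) + h (node (2*m) (2*j+2)))
          = ∫ s in (0:ℝ)..1, ∑ j ∈ Finset.range m, (P (x + (node (2*m) (2*j) - x) * s) - 2 * P (x + (node (2*m) (2*j+1) - x) * s) + P (x + (node (2*m) (2*j+2) - x) * s)) := by
        rw [intervalIntegral.integral_finsetSum]
        · refine Finset.sum_congr rfl fun j _ => ?_
          rw [intervalIntegral.integral_add ((hii _).sub ((hii _).const_mul 2)) (hii _),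
            intervalIntegral.integral_sub (hii _) ((hii _).const_mul 2),
            intervalIntegral.integral_const_mul]
        · intro j _
          exact ((hii _).sub ((hii _).const_mul 2)).add (hii _)
      rw [e1, dist_zero_right]
      refine lt_of_le_of_lt (intervalIntegral.norm_integral_le_of_norm_le_const (C := ε/2) ?_) ?_
      · intro s hs
        rw [Set.uIoc_of_le (by norm_num)] at hs
        have hse : 0 ≤ s / m := by have := hs.1; positivity
        have := aux_pair Φ hΦi P (f' (-1)) (fun t => rfl) (x + (-1 - x) * s) (s / m) hse m
        have e2 : ∀ j : ℕ, x + (node (2*m) j - x) * s = x + (-1 - x) * s + j * (s / m) := by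
          intro j; unfold node; push_cast; field_simp; ring
        simp only [e2]
        push_cast
        rw [Real.norm_eq_abs]
        refine this.trans ?_
        have h5 : s / m < δ := by
          refine lt_of_le_of_lt ?_ hmd
          gcongr; exact hs.2
        have := hδ' (x := s / m) (by rw [dist_zero_right, Real.norm_eq_abs, abs_of_nonneg hse]; exact h5)
        rw [dist_zero_right, Real.norm_eq_abs] at this
        exact (le_abs_self _).trans this.le
      · norm_num; linarith
    have hfin := (hz.const_mul (1/2)).const_add ((h (-1) + h 1)/2)
    simp only [mul_zero, add_zero] at hfin
    refine hfin.congr' ?_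
    filter_upwards [eventually_gt_atTop 0] with m hm
    rw [aux_altsum (fun k => h (node (2*m) k)) m]
    have n0 : node (2*m) 0 = -1 := by simp [node]
    have n1 : node (2*m) (2*m) = 1 := by
      have : (m:ℝ) ≠ 0 := by exact_mod_cast hm.ne'
      unfold node; push_cast; field_simp; ring
    rw [n0, n1]

lemma aux_not_node (x : ℝ) (hirr : Irrational x) (n k : ℕ) : x ≠ node n k := by
  have e : node n k = ((2 * k / n - 1 : ℚ) : ℝ) := by unfold node; push_cast; rfl
  rw [e]
  exact hirr.ne_rat _

lemma aux_D (x : ℝ) (hx : x ∈ Set.Ioo (-1 : ℝ) 1) (hirr : Irrational x) (m : ℕ) (hm : 0 < m)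
    (M : ℕ) (hM : 0 < M) (h1 : (M:ℝ) ≤ m * (1 + x)) (h2 : (M:ℝ) ≤ m * (1 - x)) :
    m * (4 * ∑ i ∈ Finset.range M, (-1:ℝ)^i / (2 * i + 1) - 2 / M) ≤ |Dden (2*m) x| := by
  have hm0 : (0:ℝ) < m := by exact_mod_cast hm
  have hx1 := hx.1
  have hx2 := hx.2
  set u : ℝ := m * (1 + x) with hu
  have hu0 : 0 ≤ u := by apply mul_nonneg hm0.le; linarith
  have e : ∀ k : ℕ, x - node (2*m) k = (u - k) / m := by
    intro k; unfold node; rw [hu]; push_cast; field_simp; ring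
  have hD : Dden (2*m) x = m * ∑ k ∈ Finset.range (2*m+1), (-1:ℝ)^k / (u - k) := by
    unfold Dden
    rw [Finset.mul_sum]
    refine Finset.sum_congr rfl fun k _ => ?_
    rw [e, div_div_eq_mul_div]; ring
  have hne : ∀ k : ℕ, u ≠ k := by
    intro k hk
    apply aux_not_node x hirr (2*m) k
    have := e k
    rw [hk, sub_self, zero_div] at this
    linarith
  have hf1 : (⌊u⌋₊:ℝ) ≤ u := Nat.floor_le hu0
  have hf2 : u < ⌊u⌋₊ + 1 := Nat.lt_floor_add_one u
  have hlt : (⌊u⌋₊:ℝ) < u := lt_of_le_of_ne hf1 (hne _).symm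
  have hk : ⌊u⌋₊ < 2*m := by
    have : (⌊u⌋₊:ℝ) < ((2*m:ℕ):ℝ) := by push_cast; nlinarith
    exact_mod_cast this
  have hp : M ≤ ⌊u⌋₊ + 1 := by
    have : (M:ℝ) ≤ ((⌊u⌋₊+1:ℕ):ℝ) := by push_cast; linarith
    exact_mod_cast this
  have hq : M + ⌊u⌋₊ ≤ 2*m := by
    have : ((M + ⌊u⌋₊:ℕ):ℝ) ≤ ((2*m:ℕ):ℝ) := by push_cast; nlinarith
    exact_mod_cast this
  have := aux_S u (2*m) ⌊u⌋₊ hk hlt hf2 M hM hp (by omega)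
  rw [hD, abs_mul, abs_of_pos hm0]
  exact mul_le_mul_of_nonneg_left this hm0.le

/-- for `f ∈ AC¹`, irrational `x ∈ (-1,1)` and an even sequence along which
`n_j (B_{n_j}(f,x) - f(x))` converges in `ℝ ∪ {±∞}`, the limit `L` is finite and
`|L| ≤ 2|E(f,x)|/π`. -/
theorem statement5 (f : ℝ → ℝ) (hf : AC1 f) (x : ℝ) (hx : x ∈ Set.Ioo (-1 : ℝ) 1)
    (hirr : Irrational x) (n : ℕ → ℕ) (hmono : StrictMono n)
    (heven : ∀ j, Even (n j) ∧ 0 < n j) (L : EReal)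
    (hlim : Filter.Tendsto
      (fun j : ℕ => (((n j : ℝ) * (berrut f (n j) x - f x) : ℝ) : EReal))
      Filter.atTop (nhds L)) :
    ∃ l : ℝ, L = (l : EReal) ∧ |l| ≤ 2 * |Efun f x| / Real.pi := by
  choose m hm using fun j => (heven j).1
  have hm2 : ∀ j, n j = 2 * m j := fun j => by rw [hm j]; ring
  have hmpos : ∀ j, 0 < m j := fun j => by have := (heven j).2; have := hm2 j; omega
  have hmt : Tendsto m atTop atTop := by
    have h1 := hmono.tendsto_atTop
    rw [tendsto_atTop] at h1 ⊢
    intro b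
    filter_upwards [h1 (2*b)] with j hj
    have := hm2 j
    omega
  obtain ⟨h, hh, hlimh⟩ := aux_h f hf x hx
  have hx1 := hx.1
  have hx2 := hx.2
  have hE : Efun f x = -((h (-1) + h 1)/2) := by
    unfold Efun
    rw [hh 1 (by norm_num), hh (-1) (by norm_num)]
    have : x - 1 ≠ 0 := by linarith
    have : x + 1 ≠ 0 := by linarith
    field_simp
    ring
  set c : ℝ := min (1+x) (1-x) with hc
  have hc0 : 0 < c := lt_min (by linarith) (by linarith)
  set M : ℕ → ℕ := fun j => ⌊(m j:ℝ) * c⌋₊ with hMdef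
  have hMt : Tendsto M atTop atTop :=
    tendsto_nat_floor_atTop.comp ((tendsto_natCast_atTop_atTop.comp hmt).atTop_mul_const hc0)
  set Q : ℕ → ℝ := fun j => 4 * ∑ i ∈ Finset.range (M j), (-1:ℝ)^i / (2 * i + 1) - 2 / (M j) with hQ
  have hQt : Tendsto Q atTop (nhds Real.pi) := by
    have h1 := (Real.tendsto_sum_pi_div_four.comp hMt).const_mul 4
    have h2 := (tendsto_const_div_atTop_nhds_zero_nat (2:ℝ)).comp hMt
    have h3 := h1.sub h2
    have e4 : 4 * (Real.pi / 4) - 0 = Real.pi := by ring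
    rw [e4] at h3
    exact h3
  set R : ℕ → ℝ := fun j => ∑ k ∈ Finset.range (2*(m j)+1), (-1:ℝ)^k * h (node (2*(m j)) k) with hR
  have hRt : Tendsto R atTop (nhds ((h (-1) + h 1)/2)) := hlimh.comp hmt
  have hCt : Tendsto (fun j => 2 * |R j| / Q j) atTop (nhds (2 * |Efun f x| / Real.pi)) := by
    rw [hE, abs_neg]
    exact (hRt.abs.const_mul 2).div hQt Real.pi_ne_zero
  have hbound : ∀ᶠ j in atTop, |(n j : ℝ) * (berrut f (n j) x - f x)| ≤ 2 * |R j| / Q j := by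
    filter_upwards [hMt.eventually_gt_atTop 0, hQt.eventually_const_lt Real.pi_pos] with j hMj hQj
    have hm0 : (0:ℝ) < m j := by exact_mod_cast hmpos j
    have hMle : (M j:ℝ) ≤ m j * c := Nat.floor_le (by positivity)
    have hD := aux_D x hx hirr (m j) (hmpos j) (M j) hMj
      (hMle.trans (mul_le_mul_of_nonneg_left (min_le_left _ _) hm0.le))
      (hMle.trans (mul_le_mul_of_nonneg_left (min_le_right _ _) hm0.le))
    change (m j:ℝ) * Q j ≤ _ at hD
    have hDpos : 0 < |Dden (2 * m j) x| := lt_of_lt_of_le (by positivity) hD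
    have hD0 : Dden (2 * m j) x ≠ 0 := abs_pos.1 hDpos
    have hnn : ¬ isNode (2 * m j) x := by
      rintro ⟨k, _, hk⟩
      exact aux_not_node x hirr _ k hk
    have hN : Nnum f (2 * m j) x - f x * Dden (2 * m j) x = - R j := by
      unfold Nnum Dden
      rw [hR, Finset.mul_sum, ← Finset.sum_sub_distrib, ← Finset.sum_neg_distrib]
      refine Finset.sum_congr rfl fun k hk => ?_
      have hkm : k ≤ 2 * m j := by simpa [Nat.lt_succ_iff] using hk
      have hne : x - node (2 * m j) k ≠ 0 := sub_ne_zero.2 (aux_not_node x hirr _ k)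
      have hmem : node (2 * m j) k ∈ Set.Icc (-1:ℝ) 1 := by
        have hkm' : (k:ℝ) ≤ 2 * m j := by exact_mod_cast hkm
        unfold node
        push_cast
        constructor
        · have : 0 ≤ 2 * (k:ℝ) / (2 * m j) := by positivity
          linarith
        · have : 2 * (k:ℝ) / (2 * m j) ≤ 2 := by
            rw [div_le_iff₀ (by positivity)]; linarith
          linarith
      have h5 := hh _ hmem
      have h6 : f (node (2 * m j) k) = f x + (node (2 * m j) k - x) * h (node (2 * m j) k) := by linarith
      rw [h6]
      field_simp
      ring
    have hB : berrut f (2 * m j) x - f x = - R j / Dden (2 * m j) x := by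
      unfold berrut
      rw [if_neg hnn, ← hN]
      field_simp
    rw [hm2 j, hB, abs_mul, abs_div, abs_neg]
    push_cast
    rw [abs_of_pos (by positivity : (0:ℝ) < 2 * m j), le_div_iff₀ hQj, mul_div_assoc', div_mul_eq_mul_div,
      div_le_iff₀ hDpos]
    nlinarith [abs_nonneg (R j), mul_le_mul_of_nonneg_left hD (abs_nonneg (R j))]
  set C : ℝ := 2 * |Efun f x| / Real.pi with hC
  have hCt' : Tendsto (fun j => ((2 * |R j| / Q j : ℝ) : EReal)) atTop (nhds (C : EReal)) :=
    (continuous_coe_real_ereal.tendsto C).comp hCt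
  have hCt'' : Tendsto (fun j => ((-(2 * |R j| / Q j) : ℝ) : EReal)) atTop (nhds ((-C : ℝ) : EReal)) :=
    (continuous_coe_real_ereal.tendsto (-C)).comp hCt.neg
  have hup : L ≤ (C : EReal) := le_of_tendsto_of_tendsto hlim hCt' (by
    filter_upwards [hbound] with j hj
    exact EReal.coe_le_coe_iff.2 (abs_le.1 hj).2)
  have hlo : ((-C : ℝ) : EReal) ≤ L := le_of_tendsto_of_tendsto hCt'' hlim (by
    filter_upwards [hbound] with j hj
    exact EReal.coe_le_coe_iff.2 (abs_le.1 hj).1)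
  induction L with
  | bot => exact absurd (le_bot_iff.1 hlo) (EReal.coe_ne_bot _)
  | top => exact absurd (top_le_iff.1 hup) (EReal.coe_ne_top _)
  | coe l =>
    exact ⟨l, rfl, abs_le.2 ⟨EReal.coe_le_coe_iff.1 hlo, EReal.coe_le_coe_iff.1 hup⟩⟩
end
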